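/- arXiv:2107.10819 — 5 statements merged into one kernel-verified Lean document; each statement's English description precedes it below -/
import Mathlib

section
/- Let ℓ ≥ 1. The number of orbits of the group B_{SO(2ℓ)} acting on the set of maximal isotropic flags in ℂ^{2ℓ+1} equals |SPIL(ℓ∪{0})|; that is, the cardinality of the quotient of the set of such flags by the B_{SO(2ℓ)}-orbit equivalence relation equals the number of signed partitions into lists of {0,1,…,ℓ}. -/
open scoped BigOperators

noncomputable section

/-- A signed list on a finite set `A` of nonnegative integers (thought of as `A' ∪ {0}`):
a nonempty finite sequence of integers whose absolute values are pairwise distinct and lie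
in `A`, whose last entry is nonnegative, and in which `0`, if it occurs, is the last entry. -/
def IsSignedList0 (A : Finset ℕ) (l : List ℤ) : Prop :=
  l ≠ [] ∧ (∀ x ∈ l, x.natAbs ∈ A) ∧ (l.map Int.natAbs).Nodup ∧
    0 ≤ l.getLastD (-1) ∧ ((0 : ℤ) ∈ l → l.getLastD (-1) = 0)

/-- `P` is a signed partition into lists of the finite set `A` (meant to contain `0`). -/
def IsSPIL0 (A : Finset ℕ) (P : Finset (List ℤ)) : Prop :=
  (∀ l ∈ P, IsSignedList0 A l) ∧
  (∀ l ∈ P, ∀ l' ∈ P, l ≠ l' →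
    Disjoint (l.map Int.natAbs).toFinset (l'.map Int.natAbs).toFinset) ∧
  P.biUnion (fun l => (l.map Int.natAbs).toFinset) = A

/-- `|SPIL(ℓ ∪ {0})|`: the number of signed partitions into lists of `{0, 1, …, ℓ}`. -/
def spil0Count (ℓ : ℕ) : ℕ :=
  Set.ncard {P : Finset (List ℤ) | IsSPIL0 (Finset.range (ℓ + 1)) P}

/-- The symmetric bilinear form `β(x, y) = xᵀ S y` on `ℂⁿ`, where `S` is the permutation
matrix sending `eᵢ` to `e_{n+1-i}`. -/
def bform (n : ℕ) (x y : Fin n → ℂ) : ℂ :=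
  ∑ i : Fin n, x i * y (⟨n - 1 - (i : ℕ), by have := i.isLt; omega⟩ : Fin n)

/-- Membership in `SO(n) = {g ∈ SL(n, ℂ) : β(gx, gy) = β(x, y)}`. -/
def memSO (n : ℕ) (g : Matrix (Fin n) (Fin n) ℂ) : Prop :=
  g.det = 1 ∧ ∀ x y : Fin n → ℂ, bform n (g.mulVec x) (g.mulVec y) = bform n x y

/-- Membership in the subgroup `B_{SO(2ℓ)}` of `SO(2ℓ+1)`: upper triangular elements of
`SO(2ℓ+1)` fixing `e_{ℓ+1}` (0-indexed: index `ℓ`). -/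
def memBB (ℓ : ℕ) (g : Matrix (Fin (2 * ℓ + 1)) (Fin (2 * ℓ + 1)) ℂ) : Prop :=
  memSO (2 * ℓ + 1) g ∧
  (∀ i j : Fin (2 * ℓ + 1), (j : ℕ) < (i : ℕ) → g i j = 0) ∧
  g.mulVec (Pi.single (⟨ℓ, by omega⟩ : Fin (2 * ℓ + 1)) (1 : ℂ)) =
    Pi.single (⟨ℓ, by omega⟩ : Fin (2 * ℓ + 1)) (1 : ℂ)

/-- A maximal isotropic flag in `ℂ^{2ℓ+1}`: a chain `V₁ ⊂ ⋯ ⊂ V_ℓ` of isotropic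
subspaces with `dim Vᵢ = i`. -/
structure FlagB (ℓ : ℕ) where
  V : Fin ℓ → Submodule ℂ (Fin (2 * ℓ + 1) → ℂ)
  mono : ∀ i j, i ≤ j → V i ≤ V j
  dimV : ∀ i, Module.finrank ℂ (V i) = (i : ℕ) + 1
  isot : ∀ i, ∀ u ∈ V i, ∀ w ∈ V i, bform (2 * ℓ + 1) u w = 0

/-- Two maximal isotropic flags lie in the same `B_{SO(2ℓ)}`-orbit. -/
def flagBRel (ℓ : ℕ) (F F' : FlagB ℓ) : Prop :=
  ∃ g, memBB ℓ g ∧ ∀ i, (F'.V i).map (Matrix.toLin' g) = F.V i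

/-! ### Bilinearity of the form -/

lemma bform_eq (n : ℕ) (x y : Fin n → ℂ) : bform n x y = ∑ i : Fin n, x i * y i.rev := by
  unfold bform
  refine Finset.sum_congr rfl fun i _ => ?_
  congr 2
  ext
  simp only [Fin.val_rev]
  omega

lemma bform_symm (n : ℕ) (x y : Fin n → ℂ) : bform n x y = bform n y x := by
  rw [bform_eq, bform_eq]
  refine Fintype.sum_equiv Fin.revPerm _ _ fun i => ?_
  simp [mul_comm]

lemma bform_add_left (n : ℕ) (x y z : Fin n → ℂ) :
    bform n (x + y) z = bform n x z + bform n y z := by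
  simp [bform_eq, add_mul, Finset.sum_add_distrib]

lemma bform_add_right (n : ℕ) (x y z : Fin n → ℂ) :
    bform n z (x + y) = bform n z x + bform n z y := by
  simp [bform_eq, mul_add, Finset.sum_add_distrib]

lemma bform_smul_left (n : ℕ) (c : ℂ) (x z : Fin n → ℂ) :
    bform n (c • x) z = c * bform n x z := by
  simp [bform_eq, Finset.mul_sum, mul_assoc]

lemma bform_smul_right (n : ℕ) (c : ℂ) (x z : Fin n → ℂ) :
    bform n z (c • x) = c * bform n z x := by
  rw [bform_symm, bform_smul_left, bform_symm]

lemma bform_neg_left (n : ℕ) (x z : Fin n → ℂ) :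
    bform n (-x) z = - bform n x z := by
  simp [bform_eq]

lemma bform_neg_right (n : ℕ) (x z : Fin n → ℂ) :
    bform n z (-x) = - bform n z x := by
  simp [bform_eq]

lemma bform_sub_left (n : ℕ) (x y z : Fin n → ℂ) :
    bform n (x - y) z = bform n x z - bform n y z := by
  simp [bform_eq, sub_mul, Finset.sum_sub_distrib]

lemma bform_sub_right (n : ℕ) (x y z : Fin n → ℂ) :
    bform n z (x - y) = bform n z x - bform n z y := by
  simp [bform_eq, mul_sub, Finset.sum_sub_distrib]

lemma bform_zero_left (n : ℕ) (z : Fin n → ℂ) : bform n 0 z = 0 := by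
  simp [bform_eq]

lemma bform_zero_right (n : ℕ) (z : Fin n → ℂ) : bform n z 0 = 0 := by
  simp [bform_eq]

lemma bform_sum_left (n : ℕ) {ι : Type*} (s : Finset ι) (f : ι → Fin n → ℂ) (z : Fin n → ℂ) :
    bform n (∑ i ∈ s, f i) z = ∑ i ∈ s, bform n (f i) z := by
  classical
  induction s using Finset.induction_on with
  | empty => simp [bform_zero_left]
  | insert a s ha ih => rw [Finset.sum_insert ha, Finset.sum_insert ha, bform_add_left, ih]

lemma bform_sum_right (n : ℕ) {ι : Type*} (s : Finset ι) (f : ι → Fin n → ℂ) (z : Fin n → ℂ) :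
    bform n z (∑ i ∈ s, f i) = ∑ i ∈ s, bform n z (f i) := by
  rw [bform_symm, bform_sum_left]
  exact Finset.sum_congr rfl fun i _ => bform_symm _ _ _

lemma bform_single_left (n : ℕ) (i : Fin n) (z : Fin n → ℂ) :
    bform n (Pi.single i 1) z = z i.rev := by
  rw [bform_eq, Finset.sum_eq_single i]
  · simp
  · intro j _ hj
    simp [hj]
  · simp

lemma bform_single_right (n : ℕ) (i : Fin n) (z : Fin n → ℂ) :
    bform n z (Pi.single i 1) = z i.rev := by
  rw [bform_symm, bform_single_left]

/-! ### Hyperbolic bases adapted to the standard flag -/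

/-- A hyperbolic basis compatible with the standard flag. -/
structure Hyp (n : ℕ) (b : Fin n → Fin n → ℂ) : Prop where
  gram : ∀ i j, bform n (b i) (b j) = if j = i.rev then 1 else 0
  tri : ∀ i j, i < j → b i j = 0

lemma Hyp.comp {n : ℕ} {b : Fin n → Fin n → ℂ} (h : Hyp n b) (j k : Fin n) :
    ∑ m : Fin n, b m.rev j.rev * b m k = if j = k then 1 else 0 := by
  let M : Matrix (Fin n) (Fin n) ℂ := Matrix.of fun i j => b i j
  let M' : Matrix (Fin n) (Fin n) ℂ := Matrix.of fun j m => b m.rev j.rev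
  have h1 : M * M' = 1 := by
    ext i m
    have := h.gram i m.rev
    rw [bform_eq] at this
    simp only [Matrix.mul_apply, M, M', Matrix.of_apply, Matrix.one_apply, this]
    simp only [Fin.rev_inj, eq_comm]
  have h2 : M' * M = 1 := mul_eq_one_comm.mp h1
  have := congrFun (congrFun h2 j) k
  simpa [Matrix.mul_apply, M, M', Matrix.one_apply] using this

lemma Hyp.expand {n : ℕ} {b : Fin n → Fin n → ℂ} (h : Hyp n b) (x : Fin n → ℂ) :
    x = ∑ m : Fin n, bform n x (b m.rev) • b m := by
  ext k
  simp only [Finset.sum_apply, Pi.smul_apply, smul_eq_mul, bform_eq, Finset.sum_mul]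
  rw [Finset.sum_comm]
  have : ∀ j, ∑ m : Fin n, x j * b m.rev j.rev * b m k = x j * if j = k then 1 else 0 := by
    intro j
    rw [← h.comp j k, Finset.mul_sum]
    exact Finset.sum_congr rfl fun _ _ => by ring
  simp [this]

lemma Hyp.coef_zero {n : ℕ} {b : Fin n → Fin n → ℂ} (h : Hyp n b) {x : Fin n → ℂ} {m : Fin n}
    (hx : ∀ k, m < k → x k = 0) {k : Fin n} (hk : m < k) : bform n x (b k.rev) = 0 := by
  rw [bform_eq]
  refine Finset.sum_eq_zero fun j _ => ?_
  rcases lt_or_ge m j with hj | hj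
  · simp [hx j hj]
  · rw [h.tri k.rev j.rev (Fin.rev_lt_rev.mpr (lt_of_le_of_lt hj hk)), mul_zero]

lemma Hyp.coef_lead {n : ℕ} {b : Fin n → Fin n → ℂ} (h : Hyp n b) {x : Fin n → ℂ} {m : Fin n}
    (hx : ∀ k, m < k → x k = 0) : bform n x (b m.rev) = x m * b m.rev m.rev := by
  rw [bform_eq]
  refine Finset.sum_eq_single m (fun j _ hj => ?_) (by simp)
  rcases lt_or_gt_of_ne hj with hj | hj
  · rw [h.tri m.rev j.rev (Fin.rev_lt_rev.mpr hj), mul_zero]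
  · simp [hx j hj]

lemma Hyp.diag {n : ℕ} {b : Fin n → Fin n → ℂ} (h : Hyp n b) (m : Fin n) :
    b m m * b m.rev m.rev = 1 := by
  rw [← h.coef_lead (h.tri m), h.gram]
  simp

lemma Hyp.diag_ne {n : ℕ} {b : Fin n → Fin n → ℂ} (h : Hyp n b) (m : Fin n) : b m m ≠ 0 := by
  intro h0
  have := h.diag m
  simp [h0] at this

lemma Hyp.linInd {n : ℕ} {b : Fin n → Fin n → ℂ} (h : Hyp n b) : LinearIndependent ℂ b := by
  rw [Fintype.linearIndependent_iff]
  intro g hg i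
  have h1 : bform n (∑ j, g j • b j) (b i.rev) = 0 := by rw [hg, bform_zero_left]
  rw [bform_sum_left] at h1
  simpa [bform_smul_left, h.gram, Fin.rev_inj, eq_comm] using h1

/-- A nonzero vector has a leading position. -/
lemma exists_lead {n : ℕ} {x : Fin n → ℂ} (hx : x ≠ 0) :
    ∃ m, x m ≠ 0 ∧ ∀ k, m < k → x k = 0 := by
  classical
  have hne : (Finset.univ.filter fun m => x m ≠ 0).Nonempty := by
    by_contra hcon
    apply hx
    ext m
    by_contra hm
    exact hcon ⟨m, by simpa using hm⟩
  refine ⟨Finset.max' _ hne, ?_, ?_⟩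
  · simpa using Finset.max'_mem _ hne
  · intro k hk
    by_contra hk0
    exact absurd (Finset.le_max' _ k (by simpa using hk0)) (not_le.mpr hk)

/-- The standard basis. -/
lemma hyp_std (n : ℕ) : Hyp n (fun i => Pi.single i 1) where
  gram i j := by
    rw [bform_single_left]
    simp [Pi.single_apply, eq_comm]
  tri i j hij := by simp [hij.ne']

/-- The middle index. -/
def mid (ℓ : ℕ) : Fin (2 * ℓ + 1) := ⟨ℓ, by omega⟩

lemma rev_mid (ℓ : ℕ) : (mid ℓ).rev = mid ℓ := by
  ext
  simp only [Fin.val_rev, mid]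
  omega

lemma rev_eq_self_iff {ℓ : ℕ} (m : Fin (2 * ℓ + 1)) : m.rev = m ↔ m = mid ℓ := by
  rw [Fin.ext_iff, Fin.ext_iff]
  simp only [Fin.val_rev, mid]
  omega

lemma rev_lt_mid {ℓ : ℕ} {m : Fin (2 * ℓ + 1)} (h : mid ℓ < m) : m.rev < mid ℓ := by
  rw [← rev_mid]
  exact Fin.rev_lt_rev.mpr h

/-- The element of the group carrying one hyperbolic basis to another. -/
def carry (n : ℕ) (b b' : Fin n → Fin n → ℂ) : Matrix (Fin n) (Fin n) ℂ :=
  Matrix.of fun i j => ∑ m : Fin n, b' m.rev j.rev * b m i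

lemma carry_mulVec {n : ℕ} (b b' : Fin n → Fin n → ℂ) (x : Fin n → ℂ) :
    (carry n b b').mulVec x = ∑ m, bform n x (b' m.rev) • b m := by
  ext i
  simp only [Matrix.mulVec, dotProduct, carry, Matrix.of_apply, Finset.sum_apply, Pi.smul_apply,
    smul_eq_mul, bform_eq, Finset.sum_mul]
  rw [Finset.sum_comm]
  exact Finset.sum_congr rfl fun _ _ => Finset.sum_congr rfl fun _ _ => by ring

lemma carry_apply_basis {n : ℕ} {b b' : Fin n → Fin n → ℂ} (h' : Hyp n b') (i : Fin n) :
    (carry n b b').mulVec (b' i) = b i := by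
  rw [carry_mulVec]
  simp [h'.gram]

lemma carry_tri {n : ℕ} {b b' : Fin n → Fin n → ℂ} (h : Hyp n b) (h' : Hyp n b')
    (i j : Fin n) (hij : j < i) : carry n b b' i j = 0 := by
  simp only [carry, Matrix.of_apply]
  refine Finset.sum_eq_zero fun m _ => ?_
  rcases lt_or_ge j m with hm | hm
  · rw [h'.tri _ _ (Fin.rev_lt_rev.mpr hm), zero_mul]
  · rw [h.tri _ _ (lt_of_le_of_lt hm hij), mul_zero]

lemma carry_isom {n : ℕ} {b b' : Fin n → Fin n → ℂ} (h : Hyp n b) (h' : Hyp n b')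
    (x y : Fin n → ℂ) :
    bform n ((carry n b b').mulVec x) ((carry n b b').mulVec y) = bform n x y := by
  have key : bform n x y = ∑ m, bform n x (b' m.rev) * bform n y (b' m) := by
    conv_lhs => rw [h'.expand x]
    rw [bform_sum_left]
    exact Finset.sum_congr rfl fun m _ => by rw [bform_smul_left, bform_symm n (b' m)]
  rw [key, carry_mulVec, carry_mulVec, bform_sum_left]
  refine Finset.sum_congr rfl fun m _ => ?_
  rw [bform_smul_left, bform_sum_right]
  congr 1
  simp only [bform_smul_right, h.gram]
  simp

lemma carry_memBB {ℓ : ℕ} {b b' : Fin (2 * ℓ + 1) → Fin (2 * ℓ + 1) → ℂ}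
    (h : Hyp _ b) (h' : Hyp _ b') (hm : ∀ i, b i (mid ℓ) = b' i (mid ℓ)) :
    memBB ℓ (carry _ b b') := by
  have htri := carry_tri h h'
  have hiso := carry_isom h h'
  have hfix : (carry _ b b').mulVec (Pi.single (mid ℓ) (1 : ℂ)) = Pi.single (mid ℓ) (1 : ℂ) := by
    rw [carry_mulVec]
    conv_rhs => rw [h.expand (Pi.single (mid ℓ) (1 : ℂ))]
    simp only [bform_single_left, rev_mid, hm]
  refine ⟨⟨?_, hiso⟩, fun i j hij => htri i j hij, hfix⟩
  rw [Matrix.det_of_isUpperTriangular (fun i j hij => htri i j hij)]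
  refine Finset.prod_involution (fun i _ => i.rev) ?_ ?_ ?_ ?_
  · intro i _
    have h1 := hiso (Pi.single i 1) (Pi.single i.rev 1)
    rw [bform_single_left, Matrix.mulVec_single_one, Matrix.mulVec_single_one, bform_eq,
      Finset.sum_eq_single i] at h1
    · simpa using h1
    · intro j _ hj
      rcases lt_or_gt_of_ne hj with hj | hj
      · simp [htri _ _ (Fin.rev_lt_rev.mpr hj)]
      · simp [htri _ _ hj]
    · simp
  · intro i _ hi hrev
    rw [rev_eq_self_iff] at hrev
    apply hi
    rw [hrev]
    have := congrFun hfix (mid ℓ)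
    rw [Matrix.mulVec_single_one] at this
    simpa using this
  · simp
  · simp

/-! ### Bases adapted to a flag -/

/-- A hyperbolic basis adapted to the standard flag and to a given isotropic flag. -/
structure Adp {ℓ : ℕ} (F : FlagB ℓ) (b : Fin (2 * ℓ + 1) → Fin (2 * ℓ + 1) → ℂ)
    (p : Fin ℓ → Fin (2 * ℓ + 1)) : Prop where
  hyp : Hyp _ b
  inj : Function.Injective p
  mem : ∀ a, b (p a) ∈ F.V a

lemma Adp.ne_rev {ℓ : ℕ} {F : FlagB ℓ} {b : Fin (2 * ℓ + 1) → Fin (2 * ℓ + 1) → ℂ}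
    {p : Fin ℓ → Fin (2 * ℓ + 1)} (h : Adp F b p) (a a' : Fin ℓ) : p a ≠ (p a').rev := by
  intro hcon
  have h1 := F.isot (max a a') _ (F.mono _ _ (le_max_right _ _) (h.mem a')) _
    (F.mono _ _ (le_max_left _ _) (h.mem a))
  rw [h.hyp.gram, if_pos hcon] at h1
  exact one_ne_zero h1

lemma Adp.ne_mid {ℓ : ℕ} {F : FlagB ℓ} {b : Fin (2 * ℓ + 1) → Fin (2 * ℓ + 1) → ℂ}
    {p : Fin ℓ → Fin (2 * ℓ + 1)} (h : Adp F b p) (a : Fin ℓ) : p a ≠ mid ℓ := by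
  intro hcon
  apply h.ne_rev a a
  rw [hcon, rev_mid]

lemma finrank_span_Iic {ℓ : ℕ} {b : Fin (2 * ℓ + 1) → Fin (2 * ℓ + 1) → ℂ}
    {p : Fin ℓ → Fin (2 * ℓ + 1)} (hb : Hyp _ b) (hp : Function.Injective p) (i : Fin ℓ) :
    Module.finrank ℂ (Submodule.span ℂ ((fun a => b (p a)) '' Set.Iic i)) = (i : ℕ) + 1 := by
  have h1 : LinearIndependent ℂ (fun a : Set.Iic i => b (p a)) :=
    hb.linInd.comp (fun a : Set.Iic i => p a) (hp.comp Subtype.val_injective)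
  have h2 := finrank_span_eq_card h1
  rw [Set.image_eq_range]
  rw [h2]
  simp

lemma Adp.eq_span {ℓ : ℕ} {F : FlagB ℓ} {b : Fin (2 * ℓ + 1) → Fin (2 * ℓ + 1) → ℂ}
    {p : Fin ℓ → Fin (2 * ℓ + 1)} (h : Adp F b p) (i : Fin ℓ) :
    F.V i = Submodule.span ℂ ((fun a => b (p a)) '' Set.Iic i) := by
  symm
  apply Submodule.eq_of_le_of_finrank_eq
  · rw [Submodule.span_le]
    rintro _ ⟨a, ha, rfl⟩
    exact F.mono _ _ ha (h.mem a)
  · rw [finrank_span_Iic h.hyp h.inj, F.dimV]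

lemma Adp.coef {ℓ : ℕ} {F : FlagB ℓ} {b : Fin (2 * ℓ + 1) → Fin (2 * ℓ + 1) → ℂ}
    {p : Fin ℓ → Fin (2 * ℓ + 1)} (h : Adp F b p) {i : Fin ℓ} {x : Fin (2 * ℓ + 1) → ℂ}
    (hx : x ∈ F.V i) {m : Fin (2 * ℓ + 1)} (hm : ∀ a ≤ i, p a ≠ m) :
    bform _ x (b m.rev) = 0 := by
  rw [h.eq_span] at hx
  induction hx using Submodule.span_induction with
  | mem x hx =>
    obtain ⟨a, ha, rfl⟩ := hx
    simp only [h.hyp.gram, Fin.rev_inj]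
    rw [if_neg (hm a ha).symm]
  | zero => exact bform_zero_left _ _
  | add x y _ _ hx hy => rw [bform_add_left, hx, hy, add_zero]
  | smul c x _ hx => rw [bform_smul_left, hx, mul_zero]

/-- Leading positions of the vectors in `V i` are the `p a`, `a ≤ i`. -/
lemma Adp.lead_iff {ℓ : ℕ} {F : FlagB ℓ} {b : Fin (2 * ℓ + 1) → Fin (2 * ℓ + 1) → ℂ}
    {p : Fin ℓ → Fin (2 * ℓ + 1)} (h : Adp F b p) (i : Fin ℓ) (m : Fin (2 * ℓ + 1)) :
    (∃ x ∈ F.V i, x m ≠ 0 ∧ ∀ k, m < k → x k = 0) ↔ ∃ a ≤ i, p a = m := by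
  constructor
  · rintro ⟨x, hx, hxm, hlead⟩
    by_contra hcon
    push Not at hcon
    have h1 := h.coef hx hcon
    rw [h.hyp.coef_lead hlead] at h1
    exact (mul_ne_zero hxm (h.hyp.diag_ne _)) h1
  · rintro ⟨a, ha, rfl⟩
    exact ⟨b (p a), F.mono _ _ ha (h.mem a), h.hyp.diag_ne _, h.hyp.tri _⟩

lemma Adp.unique_p {ℓ : ℕ} {F : FlagB ℓ} {b b' : Fin (2 * ℓ + 1) → Fin (2 * ℓ + 1) → ℂ}
    {p p' : Fin ℓ → Fin (2 * ℓ + 1)} (h : Adp F b p) (h' : Adp F b' p') : p = p' := by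
  have key : ∀ i m, (∃ a ≤ i, p a = m) ↔ ∃ a ≤ i, p' a = m := fun i m => by
    rw [← h.lead_iff, ← h'.lead_iff]
  funext i
  obtain ⟨a, ha, hpa⟩ := (key i (p i)).mp ⟨i, le_rfl, rfl⟩
  rcases ha.lt_or_eq with hlt | rfl
  · exfalso
    obtain ⟨c, hc, hpc⟩ := (key a (p' a)).mpr ⟨a, le_rfl, rfl⟩
    have : c = i := h.inj (hpc.trans hpa)
    omega
  · exact hpa.symm

/-- Full adaptedness: the middle coordinates are in normal form as well. -/
structure Full {ℓ : ℕ} (F : FlagB ℓ) (b : Fin (2 * ℓ + 1) → Fin (2 * ℓ + 1) → ℂ)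
    (p : Fin ℓ → Fin (2 * ℓ + 1)) (K : Fin ℓ → Bool) : Prop where
  adp : Adp F b p
  middle : ∀ n, b n (mid ℓ) = if n = mid ℓ ∨ ∃ a, K a = true ∧ p a = n then 1 else 0
  anti : ∀ a a', a < a' → K a = true → K a' = true → p a' < p a

lemma Full.mid_lt {ℓ : ℕ} {F : FlagB ℓ} {b : Fin (2 * ℓ + 1) → Fin (2 * ℓ + 1) → ℂ}
    {p : Fin ℓ → Fin (2 * ℓ + 1)} {K : Fin ℓ → Bool} (h : Full F b p K) (a : Fin ℓ)
    (ha : K a = true) : mid ℓ < p a := by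
  by_contra hcon
  have h1 := h.middle (p a)
  rw [if_pos (Or.inr ⟨a, ha, rfl⟩), h.adp.hyp.tri _ _
    (lt_of_le_of_ne (not_lt.mp hcon) (h.adp.ne_mid a))] at h1
  exact zero_ne_one h1

lemma Full.mark_iff {ℓ : ℕ} {F : FlagB ℓ} {b : Fin (2 * ℓ + 1) → Fin (2 * ℓ + 1) → ℂ}
    {p : Fin ℓ → Fin (2 * ℓ + 1)} {K : Fin ℓ → Bool} (h : Full F b p K) (i : Fin ℓ)
    (m : Fin (2 * ℓ + 1)) :
    (∃ x ∈ F.V i, x (mid ℓ) ≠ 0 ∧ ∀ k, m < k → x k = 0) ↔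
      ∃ a ≤ i, K a = true ∧ p a ≤ m := by
  constructor
  · rintro ⟨x, hx, hxm, hlead⟩
    have h1 := congrFun (h.adp.hyp.expand x) (mid ℓ)
    rw [Finset.sum_apply] at h1
    rw [h1] at hxm
    obtain ⟨n, -, hn⟩ := Finset.exists_ne_zero_of_sum_ne_zero hxm
    rw [Pi.smul_apply, smul_eq_mul] at hn
    have hc := left_ne_zero_of_mul hn
    have hb := right_ne_zero_of_mul hn
    have hex : ∃ a ≤ i, p a = n := by
      by_contra hcon
      push Not at hcon
      exact hc (h.adp.coef hx hcon)
    obtain ⟨a, ha, rfl⟩ := hex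
    refine ⟨a, ha, ?_, ?_⟩
    · rw [h.middle] at hb
      by_contra hK
      apply hb
      rw [if_neg]
      rintro (hmid | ⟨a', ha', hpa'⟩)
      · exact h.adp.ne_mid a hmid
      · exact hK (h.adp.inj hpa' ▸ ha')
    · by_contra hlt
      exact hc (h.adp.hyp.coef_zero hlead (not_le.mp hlt))
  · rintro ⟨a, ha, hK, hpm⟩
    refine ⟨b (p a), F.mono _ _ ha (h.adp.mem a), ?_, fun k hk => h.adp.hyp.tri _ _
      (lt_of_le_of_lt hpm hk)⟩
    rw [h.middle, if_pos (Or.inr ⟨a, hK, rfl⟩)]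
    exact one_ne_zero

lemma Full.unique_aux {ℓ : ℕ} {F : FlagB ℓ} {b b' : Fin (2 * ℓ + 1) → Fin (2 * ℓ + 1) → ℂ}
    {p : Fin ℓ → Fin (2 * ℓ + 1)} {K K' : Fin ℓ → Bool} (h : Full F b p K)
    (h' : Full F b' p K') (a : Fin ℓ) (ha : K a = true) : K' a = true := by
  obtain ⟨a', ha', hK', hp'⟩ :=
    (h'.mark_iff a (p a)).mp ((h.mark_iff a (p a)).mpr ⟨a, le_rfl, ha, le_rfl⟩)
  obtain ⟨c, hc, hKc, hpc⟩ :=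
    (h.mark_iff a' (p a')).mp ((h'.mark_iff a' (p a')).mpr ⟨a', le_rfl, hK', le_rfl⟩)
  rcases (hc.trans ha').lt_or_eq with hlt | heq
  · exact absurd (h.anti c a hlt hKc ha) (not_lt.mpr (hpc.trans hp'))
  · have : a' = a := le_antisymm ha' (heq ▸ hc)
    exact this ▸ hK'

lemma Full.unique {ℓ : ℕ} {F : FlagB ℓ} {b b' : Fin (2 * ℓ + 1) → Fin (2 * ℓ + 1) → ℂ}
    {p p' : Fin ℓ → Fin (2 * ℓ + 1)} {K K' : Fin ℓ → Bool} (h : Full F b p K)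
    (h' : Full F b' p' K') : p = p' ∧ K = K' := by
  obtain rfl := h.adp.unique_p h'.adp
  refine ⟨rfl, ?_⟩
  funext a
  rw [Bool.eq_iff_iff]
  exact ⟨h.unique_aux h' a, h'.unique_aux h a⟩

/-- Transport of a fully adapted basis by an element of the group. -/
lemma Full.transport {ℓ : ℕ} {F F' : FlagB ℓ} {b : Fin (2 * ℓ + 1) → Fin (2 * ℓ + 1) → ℂ}
    {p : Fin ℓ → Fin (2 * ℓ + 1)} {K : Fin ℓ → Bool} (h : Full F' b p K)
    (hr : flagBRel ℓ F F') : ∃ b', Full F b' p K := by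
  obtain ⟨g, ⟨⟨-, hiso⟩, htri, hfix⟩, hg⟩ := hr
  refine ⟨fun i => g.mulVec (b i), ⟨⟨?_, ?_⟩, h.adp.inj, ?_⟩, ?_, h.anti⟩
  · intro i j
    rw [hiso, h.adp.hyp.gram]
  · intro i j hij
    simp only [Matrix.mulVec, dotProduct]
    refine Finset.sum_eq_zero fun k _ => ?_
    rcases lt_or_ge k j with hk | hk
    · rw [htri j k hk, zero_mul]
    · rw [h.adp.hyp.tri i k (lt_of_lt_of_le hij hk), mul_zero]
  · intro a
    rw [← hg a]
    exact ⟨b (p a), h.adp.mem a, rfl⟩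
  · intro n
    rw [← h.middle]
    have h1 := hiso (b n) (Pi.single (mid ℓ) 1)
    have hfix' : g.mulVec (Pi.single (mid ℓ) (1 : ℂ)) = Pi.single (mid ℓ) 1 := hfix
    rw [hfix', bform_single_right, bform_single_right, rev_mid] at h1
    exact h1

/-- Two flags with the same combinatorial datum are in the same orbit. -/
lemma Full.related {ℓ : ℕ} {F F' : FlagB ℓ} {b b' : Fin (2 * ℓ + 1) → Fin (2 * ℓ + 1) → ℂ}
    {p : Fin ℓ → Fin (2 * ℓ + 1)} {K : Fin ℓ → Bool} (h : Full F b p K)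
    (h' : Full F' b' p K) : flagBRel ℓ F F' := by
  refine ⟨carry _ b b', carry_memBB h.adp.hyp h'.adp.hyp fun i => ?_, fun i => ?_⟩
  · rw [h.middle, h'.middle]
  · rw [h.adp.eq_span, h'.adp.eq_span, Submodule.map_span, ← Set.image_comp]
    congr 1
    refine Set.image_congr fun a _ => ?_
    simp only [Function.comp_apply, Matrix.toLin'_apply]
    exact carry_apply_basis h'.adp.hyp _

/-! ### Elementary modifications of hyperbolic bases -/

lemma Hyp.replace {n : ℕ} {b : Fin n → Fin n → ℂ} (h : Hyp n b) {f : Fin n → ℂ} {q : Fin n}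
    (hff : bform n f f = 0) (hlead : ∀ k, q < k → f k = 0) (hq1 : bform n f (b q.rev) = 1)
    (hq : q.rev ≠ q) :
    Hyp n (fun m => if m = q then f else if m = q.rev then b q.rev else
      b m - bform n (b m) f • b q.rev) where
  gram i j := by
    have hq1' : bform n (b q.rev) f = 1 := by rw [bform_symm, hq1]
    have hqq : bform n (b q.rev) (b q.rev) = 0 := by rw [h.gram]; simp [hq]
    have hr : ∀ m, m ≠ q → bform n (b q.rev) (b m) = 0 := fun m hm => by
      rw [h.gram]; simp [hm]
    have hl : ∀ m, m ≠ q → bform n (b m) (b q.rev) = 0 := fun m hm => by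
      rw [bform_symm, hr m hm]
    by_cases hi : i = q
    · subst hi
      by_cases hj : j = i
      · subst hj
        simp [hff, hq.symm]
      · by_cases hj' : j = i.rev
        · subst hj'
          simp [hq, hq1]
        · simp [hj, hj', bform_sub_right, bform_smul_right, hq1, bform_symm n f (b j)]
    · by_cases hi' : i = q.rev
      · subst hi'
        by_cases hj : j = q
        · subst hj
          simp [hq, hq1']
        · by_cases hj' : j = q.rev
          · subst hj'
            simp [hq, hqq]
          · simp [hq, hj, hj', bform_sub_right, bform_smul_right, hqq, hr]
      · by_cases hj : j = q
        · subst hj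
          have : ¬ j = i.rev := fun hc => hi' (by rw [hc, Fin.rev_rev])
          simp [hi, hi', this, bform_sub_left, bform_smul_left, hq1']
        · by_cases hj' : j = q.rev
          · subst hj'
            simp [hi, hi', hq, bform_sub_left, bform_smul_left, hqq, hl, Ne.symm hi]
          · simp [hi, hi', hj, hj', bform_sub_left, bform_smul_left, bform_sub_right,
              bform_smul_right, hqq, hl, hr, h.gram i j]
  tri i j hij := by
    by_cases hi : i = q
    · subst hi
      simp [hlead j hij]
    · by_cases hi' : i = q.rev
      · subst hi'
        simp [hq, h.tri _ _ hij]
      · simp only [hi, hi', if_false, Pi.sub_apply, Pi.smul_apply, smul_eq_mul, h.tri _ _ hij,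
          zero_sub, neg_eq_zero]
        rcases lt_or_ge i q.rev with hlt | hge
        · have : bform n (b i) f = 0 := by
            have h0 := h.coef_zero hlead (k := i.rev) (by
              rw [← Fin.rev_rev q]; exact Fin.rev_lt_rev.mpr hlt)
            rw [Fin.rev_rev] at h0
            rw [bform_symm, h0]
          rw [this, zero_mul]
        · rw [h.tri _ _ (lt_of_le_of_lt hge hij), mul_zero]

lemma Hyp.elim_mid {ℓ : ℕ} {b : Fin (2 * ℓ + 1) → Fin (2 * ℓ + 1) → ℂ} (h : Hyp _ b)
    {n : Fin (2 * ℓ + 1)} (hn : mid ℓ < n) (c : ℂ) :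
    Hyp _ (fun m => if m = n then b n - c • b (mid ℓ) - (c ^ 2 / 2) • b n.rev
      else if m = mid ℓ then b (mid ℓ) + c • b n.rev else b m) where
  gram i j := by
    have hne : n ≠ mid ℓ := hn.ne'
    have hne' : mid ℓ ≠ n := hn.ne
    have hlt := rev_lt_mid hn
    have h3 : n.rev ≠ mid ℓ := hlt.ne
    have h3' : mid ℓ ≠ n.rev := hlt.ne'
    have h4 : n.rev ≠ n := (hlt.trans hn).ne
    have h4' : n ≠ n.rev := (hlt.trans hn).ne'
    have hsw : ∀ u v : Fin (2 * ℓ + 1), u = v.rev ↔ v = u.rev := fun u v =>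
      ⟨fun hh => by rw [hh, Fin.rev_rev], fun hh => by rw [hh, Fin.rev_rev]⟩
    by_cases hi : i = n
    · subst hi
      by_cases hj : j = i
      · subst hj
        simp only [if_true, bform_sub_left, bform_sub_right, bform_smul_left, bform_smul_right,
          h.gram, rev_mid, Fin.rev_rev, h4, h4', hne, hne', h3, h3', if_false]
        ring
      · by_cases hj' : j = mid ℓ
        · subst hj'
          simp only [if_true, bform_sub_left, bform_add_right, bform_smul_left, bform_smul_right,
            h.gram, rev_mid, Fin.rev_rev, h4, h4', hne, hne', h3, h3', if_false]
          ring
        · simp only [if_true, bform_sub_left, bform_smul_left,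
            h.gram, rev_mid, Fin.rev_rev, hj, hj', if_false]
          ring
    · by_cases hi' : i = mid ℓ
      · subst hi'
        by_cases hj : j = n
        · subst hj
          simp only [if_true, bform_add_left, bform_sub_right, bform_smul_left, bform_smul_right,
            h.gram, rev_mid, Fin.rev_rev, h4, h4', hne, hne', h3, h3', if_false]
          ring
        · by_cases hj' : j = mid ℓ
          · subst hj'
            simp only [if_true, bform_add_left, bform_add_right, bform_smul_left,
              bform_smul_right,
              h.gram, rev_mid, Fin.rev_rev, h4, h4', hne, hne', h3, h3', if_false]
            ring
          · simp only [if_true, bform_add_left, bform_smul_left,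
              h.gram, rev_mid, Fin.rev_rev, hj, hj', hne', if_false]
            ring
      · have e1 : i.rev ≠ mid ℓ := fun hc => hi' (by rw [← rev_mid, ← hc, Fin.rev_rev])
        have e2 : n.rev ≠ i.rev := fun hc => hi (Fin.rev_injective hc).symm
        by_cases hj : j = n
        · subst hj
          simp only [if_true, bform_sub_right, bform_smul_right, hi, hi',
            h.gram, e1.symm, e2, if_false]
          ring
        · by_cases hj' : j = mid ℓ
          · subst hj'
            simp only [if_true, bform_add_right, bform_smul_right, hi, hi',
              h.gram, e1.symm, e2, hne', if_false]
            ring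
          · simp only [hi, hi', hj, hj', if_false, h.gram]
  tri i j hij := by
    have hlt := rev_lt_mid hn
    by_cases hi : i = n
    · subst hi
      simp [h.tri _ _ hij, h.tri _ _ (hn.trans hij), h.tri _ _ (hlt.trans (hn.trans hij))]
    · by_cases hi' : i = mid ℓ
      · subst hi'
        simp [hn.ne, h.tri _ _ hij, h.tri _ _ (hlt.trans hij)]
      · simp [hi, hi', h.tri _ _ hij]

lemma Hyp.elim_pair {k : ℕ} {b : Fin k → Fin k → ℂ} (h : Hyp _ b)
    {m n : Fin k} (hmn : m < n) (hn : n ≠ n.rev) (hm : m ≠ m.rev) (hnm : n ≠ m.rev) (c : ℂ) :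
    Hyp _ (fun i => if i = n then b n - c • b m
      else if i = m.rev then b m.rev + c • b n.rev else b i) where
  gram i j := by
    have hmn1 : m ≠ n := hmn.ne
    have hmn2 : n ≠ m := hmn.ne'
    have hnm2 : m.rev ≠ n := hnm.symm
    have e1 : n.rev ≠ m := fun hc => hnm (by rw [← hc, Fin.rev_rev])
    have e2 : m ≠ n.rev := e1.symm
    by_cases hi : i = n
    · subst hi
      by_cases hj : j = i
      · subst hj
        simp only [if_true, bform_sub_left, bform_sub_right, bform_smul_left, bform_smul_right,
          h.gram, Fin.rev_rev, hn, hm, hnm, e2, if_false]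
        ring
      · by_cases hj' : j = m.rev
        · subst hj'
          simp only [if_true, bform_sub_left, bform_add_right, bform_smul_left, bform_smul_right,
            h.gram, Fin.rev_rev, Fin.rev_inj, hnm2, hmn1, hmn2, if_false]
          ring
        · simp only [if_true, bform_sub_left, bform_smul_left,
            h.gram, hj, hj', if_false]
          ring
    · by_cases hi' : i = m.rev
      · subst hi'
        by_cases hj : j = n
        · subst hj
          simp only [if_true, bform_add_left, bform_sub_right, bform_smul_left, bform_smul_right,
            h.gram, Fin.rev_rev, hnm2, hmn1, hmn2, if_false]
          ring
        · by_cases hj' : j = m.rev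
          · subst hj'
            simp only [if_true, bform_add_left, bform_add_right, bform_smul_left,
              bform_smul_right,
              h.gram, Fin.rev_rev, hm.symm, hn.symm, hnm2, e1, if_false]
            ring
          · simp only [if_true, bform_add_left, bform_smul_left,
              h.gram, Fin.rev_rev, hj, hj', hnm2, if_false]
            ring
      · have f1 : m ≠ i.rev := fun hc => hi' (by rw [hc, Fin.rev_rev])
        have f2 : n.rev ≠ i.rev := fun hc => hi (Fin.rev_injective hc).symm
        by_cases hj : j = n
        · subst hj
          simp only [if_true, bform_sub_right, bform_smul_right, hi, hi',
            h.gram, f1, if_false]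
          ring
        · by_cases hj' : j = m.rev
          · subst hj'
            simp only [if_true, bform_add_right, bform_smul_right, hi, hi',
              h.gram, f2, hnm2, if_false]
            ring
          · simp only [hi, hi', hj, hj', if_false, h.gram]
  tri i j hij := by
    by_cases hi : i = n
    · subst hi
      simp [h.tri _ _ hij, h.tri _ _ (hmn.trans hij)]
    · by_cases hi' : i = m.rev
      · subst hi'
        simp [hnm.symm, h.tri _ _ hij, h.tri _ _ ((Fin.rev_lt_rev.mpr hmn).trans hij)]
      · simp [hi, hi', h.tri _ _ hij]

lemma Hyp.scale {k : ℕ} {b : Fin k → Fin k → ℂ} (h : Hyp _ b) (t : Fin k → ℂ)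
    (ht : ∀ i, t i * t i.rev = 1) : Hyp _ (fun i => t i • b i) where
  gram i j := by
    rw [bform_smul_left, bform_smul_right, h.gram]
    split_ifs with hj
    · rw [hj, mul_one, ht]
    · simp
  tri i j hij := by simp [h.tri _ _ hij]

/-! ### Existence of adapted bases -/

lemma bruhat_aux {ℓ : ℕ} (F : FlagB ℓ) (k : ℕ) (hk : k ≤ ℓ) :
    ∃ (b : Fin (2 * ℓ + 1) → Fin (2 * ℓ + 1) → ℂ) (p : Fin ℓ → Fin (2 * ℓ + 1)),
      Hyp _ b ∧ (∀ a a' : Fin ℓ, (a : ℕ) < k → (a' : ℕ) < k → p a = p a' → a = a') ∧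
        ∀ a : Fin ℓ, (a : ℕ) < k → b (p a) ∈ F.V a := by
  classical
  induction k with
  | zero =>
    exact ⟨_, fun _ => mid ℓ, hyp_std _, fun a a' h => absurd h (Nat.not_lt_zero _),
      fun a h => absurd h (Nat.not_lt_zero _)⟩
  | succ k ih =>
    obtain ⟨b, p, hb, hinj, hmem⟩ := ih (by omega)
    let c : Fin ℓ := ⟨k, hk⟩
    have hmemc : ∀ a : Fin ℓ, a < c → b (p a) ∈ F.V c := fun a ha =>
      F.mono a c ha.le (hmem a ha)
    let s : Finset (Fin (2 * ℓ + 1) → ℂ) := (Finset.Iio c).image fun a => b (p a)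
    have hs : Module.finrank ℂ (Submodule.span ℂ (s : Set (Fin (2 * ℓ + 1) → ℂ))) ≤ k := by
      refine (finrank_span_finset_le_card s).trans (Finset.card_image_le.trans ?_)
      simp [c]
    have hex : ∃ f ∈ F.V c, f ∉ Submodule.span ℂ (s : Set (Fin (2 * ℓ + 1) → ℂ)) := by
      by_contra hcon
      push Not at hcon
      have h1 := Submodule.finrank_mono (R := ℂ) (show F.V c ≤ _ from hcon)
      rw [F.dimV] at h1
      simp only [c] at h1
      omega
    obtain ⟨f, hf, hfs⟩ := hex
    -- remove the components along the previous vectors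
    let f₁ := f - ∑ a ∈ Finset.Iio c, bform _ f (b (p a).rev) • b (p a)
    have hsumV : ∑ a ∈ Finset.Iio c, bform _ f (b (p a).rev) • b (p a) ∈ F.V c :=
      Submodule.sum_mem _ fun a ha =>
        Submodule.smul_mem _ _ (hmemc a (Finset.mem_Iio.mp ha))
    have hsumS : ∑ a ∈ Finset.Iio c, bform _ f (b (p a).rev) • b (p a) ∈
        Submodule.span ℂ (s : Set (Fin (2 * ℓ + 1) → ℂ)) :=
      Submodule.sum_mem _ fun a ha =>
        Submodule.smul_mem _ _ (Submodule.subset_span (by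
          simp only [s, Finset.coe_image]
          exact ⟨a, ha, rfl⟩))
    have hf₁ : f₁ ∈ F.V c := Submodule.sub_mem _ hf hsumV
    have hf₁0 : f₁ ≠ 0 := by
      intro h0
      rw [sub_eq_zero.mp h0] at hfs
      exact hfs hsumS
    have hcoef : ∀ a : Fin ℓ, a < c → bform _ f₁ (b (p a).rev) = 0 := by
      intro a ha
      simp only [f₁]
      rw [bform_sub_left, bform_sum_left, Finset.sum_eq_single a]
      · rw [bform_smul_left, hb.gram]
        simp
      · intro a' ha' hne
        rw [bform_smul_left, hb.gram, if_neg, mul_zero]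
        rw [Fin.rev_inj]
        exact fun hc => hne (hinj _ _ (show a' < c from Finset.mem_Iio.mp ha') ha hc.symm)
      · intro hn
        exact absurd (Finset.mem_Iio.mpr ha) hn
    obtain ⟨q, hq0, hlead⟩ := exists_lead hf₁0
    have hcq : bform _ f₁ (b q.rev) ≠ 0 := by
      rw [hb.coef_lead hlead]
      exact mul_ne_zero hq0 (hb.diag_ne _)
    have hqp : ∀ a : Fin ℓ, a < c → p a ≠ q := fun a ha hpa => hcq (hpa ▸ hcoef a ha)
    have hff : bform _ f₁ f₁ = 0 := F.isot c _ hf₁ _ hf₁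
    have hqmid : q.rev ≠ q := by
      intro hqm
      rw [bform_eq, Finset.sum_eq_single q] at hff
      · rw [hqm] at hff
        exact (mul_ne_zero hq0 hq0) hff
      · intro j _ hj
        rcases lt_or_gt_of_ne hj with hj | hj
        · rw [hlead j.rev (by rw [← hqm]; exact Fin.rev_lt_rev.mpr hj), mul_zero]
        · rw [hlead j hj, zero_mul]
      · simp
    let f₂ := (bform _ f₁ (b q.rev))⁻¹ • f₁
    have hf₂ : f₂ ∈ F.V c := Submodule.smul_mem _ _ hf₁
    have hff₂ : bform _ f₂ f₂ = 0 := F.isot c _ hf₂ _ hf₂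
    have hlead₂ : ∀ k, q < k → f₂ k = 0 := fun k hk => by simp [f₂, hlead k hk]
    have hq1 : bform _ f₂ (b q.rev) = 1 := by
      simp only [f₂]
      rw [bform_smul_left, inv_mul_cancel₀ hcq]
    refine ⟨_, Function.update p c q, hb.replace hff₂ hlead₂ hq1 hqmid, ?_, ?_⟩
    · intro a a' ha ha' h
      rcases lt_or_eq_of_le (show a ≤ c from Nat.lt_succ_iff.mp ha) with h1 | h1 <;>
      rcases lt_or_eq_of_le (show a' ≤ c from Nat.lt_succ_iff.mp ha') with h2 | h2
      · rw [Function.update_of_ne h1.ne, Function.update_of_ne h2.ne] at h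
        exact hinj a a' h1 h2 h
      · subst h2
        rw [Function.update_of_ne h1.ne, Function.update_self] at h
        exact absurd h (hqp a h1)
      · subst h1
        rw [Function.update_of_ne h2.ne, Function.update_self] at h
        exact absurd h.symm (hqp a' h2)
      · rw [h1, h2]
    · intro a ha
      rcases lt_or_eq_of_le (show a ≤ c from Nat.lt_succ_iff.mp ha) with h1 | h1
      · rw [Function.update_of_ne h1.ne]
        simp only [hqp a h1, if_false]
        have hz : bform _ (b (p a)) f₂ = 0 := F.isot c _ (hmemc a h1) _ hf₂
        split_ifs with h3
        · rw [← h3]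
          exact hmem a h1
        · rw [hz, zero_smul, sub_zero]
          exact hmem a h1
      · subst h1
        rw [Function.update_self]
        simpa using hf₂

lemma exists_adp {ℓ : ℕ} (F : FlagB ℓ) : ∃ b p, Adp F b p := by
  obtain ⟨b, p, hb, hinj, hmem⟩ := bruhat_aux F ℓ le_rfl
  exact ⟨b, p, hb, fun a a' h => hinj a a' a.isLt a'.isLt h, fun a => hmem a a.isLt⟩

/-- Nonzero middle coordinates. -/
def supp {ℓ : ℕ} (b : Fin (2 * ℓ + 1) → Fin (2 * ℓ + 1) → ℂ) : Finset (Fin (2 * ℓ + 1)) :=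
  Finset.univ.filter fun n => b n (mid ℓ) ≠ 0

lemma mem_supp {ℓ : ℕ} {b : Fin (2 * ℓ + 1) → Fin (2 * ℓ + 1) → ℂ} {n : Fin (2 * ℓ + 1)} :
    n ∈ supp b ↔ b n (mid ℓ) ≠ 0 := by
  simp [supp]

lemma elim_all {ℓ : ℕ} (F : FlagB ℓ) (p : Fin ℓ → Fin (2 * ℓ + 1)) (k : ℕ) :
    ∀ b, Adp F b p → b (mid ℓ) (mid ℓ) = 1 → (supp b).card = k →
      ∃ b', Adp F b' p ∧ b' (mid ℓ) (mid ℓ) = 1 ∧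
        (∀ n, n ≠ mid ℓ → b' n (mid ℓ) ≠ 0 → ∃ a, p a = n) ∧
        (∀ a a', a < a' → b' (p a) (mid ℓ) ≠ 0 → b' (p a') (mid ℓ) ≠ 0 → p a' < p a) := by
  classical
  induction k using Nat.strong_induction_on with
  | _ k ih =>
    intro b h h1 hcard
    by_cases hE1 : ∀ n, n ≠ mid ℓ → b n (mid ℓ) ≠ 0 → ∃ a, p a = n
    · by_cases hE2 : ∀ a a', a < a' → b (p a) (mid ℓ) ≠ 0 → b (p a') (mid ℓ) ≠ 0 → p a' < p a
      · exact ⟨b, h, h1, hE1, hE2⟩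
      · push Not at hE2
        obtain ⟨a, a', haa, ha, ha', hle⟩ := hE2
        have hlt : p a < p a' := lt_of_le_of_ne hle fun hc => haa.ne (h.inj hc)
        have hgt : mid ℓ < p a := by
          by_contra hcon
          exact ha (h.hyp.tri _ _ (lt_of_le_of_ne (not_lt.mp hcon) (h.ne_mid a)))
        have hrev := rev_lt_mid hgt
        set c := b (p a') (mid ℓ) / b (p a) (mid ℓ) with hc
        have hH := h.hyp.elim_pair hlt (h.ne_rev a' a') (h.ne_rev a a) (h.ne_rev a' a) c
        have hb'1 : ∀ n, n ≠ p a' → n ≠ (p a).rev → (if n = p a' then b (p a') - c • b (p a)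
            else if n = (p a).rev then b (p a).rev + c • b (p a').rev else b n) = b n := by
          intro n hn hn'
          rw [if_neg hn, if_neg hn']
        refine ih _ ?_ _ ⟨hH, h.inj, ?_⟩ ?_ rfl
        · rw [← hcard]
          apply Finset.card_lt_card
          rw [Finset.ssubset_iff_of_subset]
          · refine ⟨p a', mem_supp.mpr ha', ?_⟩
            rw [mem_supp, not_not]
            simp only [if_true, Pi.sub_apply, Pi.smul_apply, smul_eq_mul, hc]
            field_simp
            ring
          · intro n hn
            rw [mem_supp] at hn ⊢
            by_cases hn1 : n = p a'
            · rw [hn1]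
              exact ha'
            · by_cases hn2 : n = (p a).rev
              · exfalso
                apply hn
                subst hn2
                have hrev' := rev_lt_mid (hgt.trans hlt)
                simp only [hn1, if_false, if_true, Pi.add_apply, Pi.smul_apply,
                  h.hyp.tri _ _ hrev, h.hyp.tri _ _ hrev', smul_zero, add_zero]
              · rw [hb'1 n hn1 hn2] at hn
                exact hn
        · intro d
          by_cases hd : d = a'
          · subst hd
            simp only [if_true]
            exact Submodule.sub_mem _ (h.mem d)
              (Submodule.smul_mem _ _ (F.mono _ _ haa.le (h.mem a)))
          · simp only [hb'1 (p d) (fun hh => hd (h.inj hh)) (h.ne_rev d a)]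
            exact h.mem d
        · simp only [hb'1 (mid ℓ) (h.ne_mid a').symm hrev.ne']
          exact h1
    · push Not at hE1
      obtain ⟨n, hn, hn0, hnp⟩ := hE1
      have hgt : mid ℓ < n := by
        by_contra hcon
        exact hn0 (h.hyp.tri _ _ (lt_of_le_of_ne (not_lt.mp hcon) hn))
      have hrev := rev_lt_mid hgt
      have hH := h.hyp.elim_mid hgt (b n (mid ℓ))
      refine ih _ ?_ _ ⟨hH, h.inj, ?_⟩ ?_ rfl
      · rw [← hcard]
        apply Finset.card_lt_card
        rw [Finset.ssubset_iff_of_subset]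
        · refine ⟨n, mem_supp.mpr hn0, ?_⟩
          rw [mem_supp, not_not]
          simp only [if_true, Pi.sub_apply, Pi.smul_apply, smul_eq_mul, h1,
            h.hyp.tri _ _ hrev]
          ring
        · intro m hm
          rw [mem_supp] at hm ⊢
          by_cases hn1 : m = n
          · rw [hn1]
            exact hn0
          · by_cases hn2 : m = mid ℓ
            · rw [hn2, h1]
              exact one_ne_zero
            · simpa [hn1, hn2] using hm
      · intro d
        simp only [hnp d, h.ne_mid d, if_false]
        exact h.mem d
      · simp only [hn.symm, if_false, if_true, Pi.add_apply, Pi.smul_apply, h1,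
          h.hyp.tri _ _ hrev, smul_zero, add_zero]

lemma exists_full {ℓ : ℕ} (F : FlagB ℓ) : ∃ b p K, Full F b p K := by
  classical
  obtain ⟨b₀, p, h₀⟩ := exists_adp F
  -- normalise the sign of the middle vector
  have hd := h₀.hyp.diag (mid ℓ)
  rw [rev_mid] at hd
  have h1 : Adp F (fun i => (if i = mid ℓ then b₀ (mid ℓ) (mid ℓ) else 1) • b₀ i) p := by
    refine ⟨h₀.hyp.scale _ ?_, h₀.inj, fun a => Submodule.smul_mem _ _ (h₀.mem a)⟩
    intro i
    by_cases hi : i = mid ℓ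
    · subst hi
      simp [rev_mid, hd]
    · have : i.rev ≠ mid ℓ := fun hc => hi (by rw [← rev_mid, ← hc, Fin.rev_rev])
      simp [hi, this]
  obtain ⟨b, h, hm, hE1, hE2⟩ := elim_all F p _ _ h1 (by simp [hd]) rfl
  let s : Fin (2 * ℓ + 1) → ℂ := fun i => if b i (mid ℓ) = 0 then 1 else b i (mid ℓ)
  have hs : ∀ i, s i ≠ 0 := fun i => by
    simp only [s]
    split_ifs with h0
    · exact one_ne_zero
    · exact h0
  have hslt : ∀ i, i < mid ℓ → s i = 1 := fun i hi => by
    simp only [s, h.hyp.tri _ _ hi, if_true]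
  have hsm : s (mid ℓ) = 1 := by simp [s, hm]
  let t : Fin (2 * ℓ + 1) → ℂ := fun i => s i.rev / s i
  have ht : ∀ i, t i * t i.rev = 1 := fun i => by
    simp only [t, Fin.rev_rev]
    have := hs i
    have := hs i.rev
    field_simp
  have hmid : ∀ n, t n * b n (mid ℓ) = if b n (mid ℓ) = 0 then 0 else 1 := by
    intro n
    split_ifs with h0
    · rw [h0, mul_zero]
    · have hge : mid ℓ ≤ n := by
        by_contra hcon
        exact h0 (h.hyp.tri _ _ (not_le.mp hcon))
      have h2 : s n.rev = 1 := by
        rcases hge.lt_or_eq with hlt | heq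
        · exact hslt _ (rev_lt_mid hlt)
        · rw [← heq, rev_mid, hsm]
      simp only [t, h2]
      simp only [s, h0, if_false]
      field_simp
  refine ⟨fun i => t i • b i, p, fun a => decide (b (p a) (mid ℓ) ≠ 0),
    ⟨h.hyp.scale t ht, h.inj, fun a => Submodule.smul_mem _ _ (h.mem a)⟩, ?_, ?_⟩
  · intro n
    rw [Pi.smul_apply, smul_eq_mul, hmid]
    by_cases h0 : b n (mid ℓ) = 0
    · rw [if_pos h0, if_neg]
      rintro (hn | ⟨a, ha, rfl⟩)
      · rw [hn, hm] at h0
        exact one_ne_zero h0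
      · exact (of_decide_eq_true ha) h0
    · rw [if_neg h0, if_pos]
      by_cases hn : n = mid ℓ
      · exact Or.inl hn
      · obtain ⟨a, rfl⟩ := hE1 n hn h0
        exact Or.inr ⟨a, decide_eq_true h0, rfl⟩
  · intro a a' haa ha ha'
    exact hE2 a a' haa (of_decide_eq_true ha) (of_decide_eq_true ha')

/-! ### Construction of a flag from a combinatorial datum -/

/-- The combinatorial data indexing the orbits. -/
structure IsDatum (ℓ : ℕ) (d : (Fin ℓ → Fin (2 * ℓ + 1)) × (Fin ℓ → Bool)) : Prop where
  inj : Function.Injective d.1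
  ne_rev : ∀ a a', d.1 a ≠ (d.1 a').rev
  mid_lt : ∀ a, d.2 a = true → mid ℓ < d.1 a
  anti : ∀ a a', a < a' → d.2 a = true → d.2 a' = true → d.1 a' < d.1 a

lemma exists_flag {ℓ : ℕ} {d : (Fin ℓ → Fin (2 * ℓ + 1)) × (Fin ℓ → Bool)} (hd : IsDatum ℓ d) :
    ∃ F b, Full F b d.1 d.2 := by
  classical
  obtain ⟨p, K⟩ := d
  let κ : Fin (2 * ℓ + 1) → ℂ := fun n => if ∃ a, K a = true ∧ p a = n then 1 else 0
  have hκ : ∀ n, n ≤ mid ℓ → κ n = 0 := by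
    intro n hn
    simp only [κ]
    rw [if_neg]
    rintro ⟨a, ha, rfl⟩
    exact absurd (hd.mid_lt a ha) (not_lt.mpr hn)
  let e : Fin (2 * ℓ + 1) → Fin (2 * ℓ + 1) → ℂ := fun i => Pi.single i 1
  let u : Fin (2 * ℓ + 1) → ℂ := fun n => κ n.rev
  have hu : ∀ n, mid ℓ ≤ n → u n = 0 := by
    intro n hn
    apply hκ
    rw [← rev_mid]
    exact Fin.rev_le_rev.mpr hn
  have heu : ∀ n, bform _ (e n) u = κ n := fun n => by
    simp only [e, bform_single_left, u, Fin.rev_rev]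
  have hue : ∀ n, bform _ u (e n) = κ n := fun n => by rw [bform_symm, heu]
  have huu : bform _ u u = 0 := by
    rw [bform_eq]
    refine Finset.sum_eq_zero fun n _ => ?_
    rcases le_total (mid ℓ) n with hn | hn
    · rw [hu n hn, zero_mul]
    · rw [hu n.rev (by rw [← rev_mid]; exact Fin.rev_le_rev.mpr hn), mul_zero]
  let δ : Fin (2 * ℓ + 1) → ℂ := fun n => if n = mid ℓ then 1 else 0
  have hee : ∀ i j, bform _ (e i) (e j) = if j = i.rev then 1 else 0 := (hyp_std _).gram
  have hem : ∀ i, bform _ (e i) (e (mid ℓ)) = δ i := fun i => by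
    rw [bform_symm, hee, rev_mid]
  have hme : ∀ i, bform _ (e (mid ℓ)) (e i) = δ i := fun i => by
    rw [hee, rev_mid]
  have hκm : κ (mid ℓ) = 0 := hκ _ le_rfl
  have hδm : δ (mid ℓ) = 1 := by simp [δ]
  let b : Fin (2 * ℓ + 1) → Fin (2 * ℓ + 1) → ℂ := fun n =>
    e n + κ n • e (mid ℓ) - (δ n + κ n / 2) • u
  have hb : Hyp _ b := by
    constructor
    · intro i j
      simp only [b, bform_sub_left, bform_sub_right, bform_add_left, bform_add_right,
        bform_smul_left, bform_smul_right, heu, hue, huu, hem, hme, hκm, hδm]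
      rw [hee]
      ring
    · intro i j hij
      simp only [b, Pi.sub_apply, Pi.add_apply, Pi.smul_apply, smul_eq_mul, e]
      rw [Pi.single_eq_of_ne hij.ne']
      rcases lt_or_ge i (mid ℓ) with hi | hi
      · simp [hκ i hi.le, δ, hi.ne]
      · rw [hu j (hi.trans hij.le), Pi.single_eq_of_ne (lt_of_le_of_lt hi hij).ne']
        simp
  have hbm : ∀ n, b n (mid ℓ) = if n = mid ℓ ∨ ∃ a, K a = true ∧ p a = n then 1 else 0 := by
    intro n
    simp only [b, Pi.sub_apply, Pi.add_apply, Pi.smul_apply, smul_eq_mul, hu _ le_rfl, e]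
    by_cases hn : n = mid ℓ
    · subst hn
      simp [hκm]
    · rw [Pi.single_eq_of_ne (Ne.symm hn)]
      simp [hn, κ]
  have hiso : ∀ i : Fin ℓ, ∀ x ∈ Submodule.span ℂ ((fun a => b (p a)) '' Set.Iic i),
      ∀ y ∈ Submodule.span ℂ ((fun a => b (p a)) '' Set.Iic i), bform (2 * ℓ + 1) x y = 0 := by
    intro i x hx y hy
    induction hx using Submodule.span_induction with
    | mem x hx =>
      obtain ⟨a, -, rfl⟩ := hx
      induction hy using Submodule.span_induction with
      | mem y hy =>
        obtain ⟨a', -, rfl⟩ := hy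
        simp only [hb.gram]
        rw [if_neg (hd.ne_rev a' a)]
      | zero => exact bform_zero_right _ _
      | add x y _ _ hx hy => rw [bform_add_right, hx, hy, add_zero]
      | smul c x _ hx => rw [bform_smul_right, hx, mul_zero]
    | zero => exact bform_zero_left _ _
    | add x y _ _ hx hy => rw [bform_add_left, hx, hy, add_zero]
    | smul c x _ hx => rw [bform_smul_left, hx, mul_zero]
  let F : FlagB ℓ :=
    { V := fun i => Submodule.span ℂ ((fun a => b (p a)) '' Set.Iic i)
      mono := fun i j hij => Submodule.span_mono (Set.image_mono (Set.Iic_subset_Iic.mpr hij))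
      dimV := fun i => finrank_span_Iic hb hd.inj i
      isot := hiso }
  exact ⟨F, b, ⟨hb, hd.inj, fun a => Submodule.subset_span ⟨a, Set.mem_Iic.mpr le_rfl, rfl⟩⟩,
    hbm, hd.anti⟩

lemma Full.isDatum {ℓ : ℕ} {F : FlagB ℓ} {b : Fin (2 * ℓ + 1) → Fin (2 * ℓ + 1) → ℂ}
    {p : Fin ℓ → Fin (2 * ℓ + 1)} {K : Fin ℓ → Bool} (h : Full F b p K) : IsDatum ℓ (p, K) :=
  ⟨h.adp.inj, h.adp.ne_rev, h.mid_lt, h.anti⟩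

/-- Orbits correspond to combinatorial data. -/
lemma card_quot (ℓ : ℕ) : Nat.card (Quot (flagBRel ℓ)) = Nat.card {d // IsDatum ℓ d} := by
  have hex : ∀ F : FlagB ℓ, ∃ d : {d // IsDatum ℓ d}, ∃ b, Full F b d.1.1 d.1.2 := by
    intro F
    obtain ⟨b, p, K, h⟩ := exists_full F
    exact ⟨⟨(p, K), h.isDatum⟩, b, h⟩
  choose f hf using hex
  have huniq : ∀ F d b, Full F b d.1 d.2 → (f F).1 = d := by
    intro F d b h
    obtain ⟨b', h'⟩ := hf F
    obtain ⟨h1, h2⟩ := h'.unique h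
    exact Prod.ext h1 h2
  have hrel : ∀ F F', flagBRel ℓ F F' → f F = f F' := by
    intro F F' hr
    obtain ⟨b', h'⟩ := hf F'
    obtain ⟨b, h⟩ := h'.transport hr
    exact Subtype.ext (huniq F _ b h)
  refine Nat.card_congr (Equiv.ofBijective (Quot.lift f hrel) ⟨?_, ?_⟩)
  · rintro ⟨F⟩ ⟨F'⟩ (heq : f F = f F')
    apply Quot.sound
    obtain ⟨b, h⟩ := hf F
    obtain ⟨b', h'⟩ := hf F'
    rw [← heq] at h'
    exact h.related h'
  · intro d
    obtain ⟨F, b, h⟩ := exists_flag d.2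
    exact ⟨Quot.mk _ F, Subtype.ext (huniq F _ b h)⟩

/-! ### Words and lists of lists -/

/-- Last entry of a list. -/
def lastD (l : List ℤ) : ℤ := l.getLastD (-1)

/-- Encode a list by marking its last entry. -/
def enc1 : List ℤ → List (ℤ × Bool)
  | [] => []
  | [x] => [(x, true)]
  | x :: y :: t => (x, false) :: enc1 (y :: t)

/-- Encode a list of lists by a marked word. -/
def enc (L : List (List ℤ)) : List (ℤ × Bool) := L.flatMap enc1

lemma enc_cons (l : List ℤ) (L : List (List ℤ)) : enc (l :: L) = enc1 l ++ enc L := by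
  simp [enc]

lemma enc1_fst (l : List ℤ) : (enc1 l).map Prod.fst = l := by
  induction l with
  | nil => rfl
  | cons x t ih =>
    cases t with
    | nil => rfl
    | cons y t =>
      simp only [enc1, List.map_cons]
      rw [ih]

lemma lastD_cons_cons (x y : ℤ) (t : List ℤ) : lastD (x :: y :: t) = lastD (y :: t) := by
  simp [lastD]

lemma enc1_split (l : List ℤ) (hl : l ≠ []) :
    ∃ Y : List ℤ, enc1 l = Y.map (fun x => (x, false)) ++ [(lastD l, true)] := by
  induction l with
  | nil => exact absurd rfl hl
  | cons x t ih =>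
    cases t with
    | nil => exact ⟨[], by simp [enc1, lastD]⟩
    | cons y t =>
      obtain ⟨Y, hY⟩ := ih (by simp)
      refine ⟨x :: Y, ?_⟩
      rw [enc1, hY, lastD_cons_cons]
      rfl

lemma enc1_filter (l : List ℤ) (hl : l ≠ []) :
    ((enc1 l).filter Prod.snd).map Prod.fst = [lastD l] := by
  obtain ⟨Y, hY⟩ := enc1_split l hl
  have : (Y.map fun x => (x, false)).filter Prod.snd = [] := by
    rw [List.filter_eq_nil_iff]
    intro a ha
    obtain ⟨x, -, rfl⟩ := List.mem_map.mp ha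
    simp
  rw [hY, List.filter_append, this]
  simp

lemma enc_fst (L : List (List ℤ)) : (enc L).map Prod.fst = L.flatten := by
  induction L with
  | nil => rfl
  | cons l L ih => rw [enc_cons, List.map_append, enc1_fst, ih, List.flatten_cons]

lemma enc_filter (L : List (List ℤ)) (hL : ∀ l ∈ L, l ≠ []) :
    ((enc L).filter Prod.snd).map Prod.fst = L.map lastD := by
  induction L with
  | nil => rfl
  | cons l L ih =>
    rw [enc_cons, List.filter_append, List.map_append, enc1_filter l (hL l (by simp)),
      ih fun l' hl' => hL l' (by simp [hl'])]
    rfl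

lemma enc1_cancel (l l' : List ℤ) (hl : l ≠ []) (hl' : l' ≠ []) (X Y : List (ℤ × Bool))
    (h : enc1 l ++ X = enc1 l' ++ Y) : l = l' ∧ X = Y := by
  induction l generalizing l' with
  | nil => exact absurd rfl hl
  | cons x t ih =>
    match l', hl' with
    | [x'], _ =>
      cases t with
      | nil =>
        simp only [enc1, List.cons_append, List.nil_append, List.cons.injEq, Prod.mk.injEq] at h
        exact ⟨by rw [h.1.1], h.2⟩
      | cons y t => simp [enc1] at h
    | x' :: y' :: t', _ =>
      cases t with
      | nil => simp [enc1] at h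
      | cons y t =>
        simp only [enc1, List.cons_append, List.cons.injEq, Prod.mk.injEq] at h
        obtain ⟨h1, h2⟩ := ih (y' :: t') (by simp) (by simp) h.2
        exact ⟨by rw [h.1.1, h1], h2⟩

lemma enc1_ne_nil (l : List ℤ) (hl : l ≠ []) : enc1 l ≠ [] := by
  intro h
  apply hl
  rw [← enc1_fst l, h]
  rfl

lemma enc_inj (L L' : List (List ℤ)) (hL : ∀ l ∈ L, l ≠ []) (hL' : ∀ l ∈ L', l ≠ [])
    (h : enc L = enc L') : L = L' := by
  induction L generalizing L' with
  | nil =>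
    cases L' with
    | nil => rfl
    | cons l' T' =>
      rw [enc_cons] at h
      exact absurd (List.append_eq_nil_iff.mp h.symm).1 (enc1_ne_nil l' (hL' l' (by simp)))
  | cons l T ih =>
    cases L' with
    | nil =>
      rw [enc_cons] at h
      exact absurd (List.append_eq_nil_iff.mp h).1 (enc1_ne_nil l (hL l (by simp)))
    | cons l' T' =>
      rw [enc_cons, enc_cons] at h
      obtain ⟨h1, h2⟩ := enc1_cancel l l' (hL l (by simp)) (hL' l' (by simp)) _ _ h
      rw [h1, ih T' (fun m hm => hL m (by simp [hm])) (fun m hm => hL' m (by simp [hm])) h2]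

lemma exists_enc (X : List (ℤ × Bool)) :
    ∃ L : List (List ℤ), (∀ l ∈ L, l ≠ []) ∧ enc L = X ++ [(0, true)] := by
  induction X with
  | nil => exact ⟨[[0]], by simp, by simp [enc, enc1]⟩
  | cons x X ih =>
    obtain ⟨L, hL, hX⟩ := ih
    obtain ⟨x, m⟩ := x
    cases m with
    | true =>
      refine ⟨[x] :: L, ?_, ?_⟩
      · intro l hl
        rcases List.mem_cons.mp hl with rfl | hl
        · simp
        · exact hL l hl
      · rw [enc_cons, hX]
        rfl
    | false =>
      match L, hL, hX with
      | [], _, hX => simp [enc] at hX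
      | [] :: T, hL, _ => exact absurd rfl (hL [] (by simp))
      | (y :: t) :: T, hL, hX =>
        refine ⟨(x :: y :: t) :: T, ?_, ?_⟩
        · intro l hl
          rcases List.mem_cons.mp hl with rfl | hl
          · simp
          · exact hL l (by simp [hl])
        · rw [enc_cons] at hX ⊢
          rw [enc1, List.cons_append, hX]
          rfl

lemma lastD_mem (l : List ℤ) (hl : l ≠ []) : lastD l ∈ l := by
  rw [lastD, List.getLastD_eq_getLast?, List.getLast?_eq_some_getLast hl]
  exact List.getLast_mem hl

/-- Sorted lists of lists representing signed partitions. -/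
structure Good (ℓ : ℕ) (L : List (List ℤ)) : Prop where
  ne : ∀ l ∈ L, l ≠ []
  sorted : L.Pairwise fun l l' => lastD l' < lastD l
  nodup : (L.flatten.map Int.natAbs).Nodup
  mem : ∀ n, n ∈ L.flatten.map Int.natAbs ↔ n < ℓ + 1
  nonneg : ∀ l ∈ L, 0 ≤ lastD l
  zero : ∀ l ∈ L, (0 : ℤ) ∈ l → lastD l = 0

lemma nodup_flatten_natAbs (L : List (List ℤ)) :
    (L.flatten.map Int.natAbs).Nodup ↔ (∀ l ∈ L, (l.map Int.natAbs).Nodup) ∧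
      L.Pairwise fun l l' => Disjoint (l.map Int.natAbs).toFinset (l'.map Int.natAbs).toFinset := by
  rw [List.map_flatten, List.nodup_flatten, List.pairwise_map]
  refine and_congr (by simp) ?_
  refine List.Pairwise.iff_of_mem ?_
  intro l l' _ _
  rw [List.disjoint_toFinset_iff_disjoint]

lemma Good.isSPIL {ℓ : ℕ} {L : List (List ℤ)} (h : Good ℓ L) :
    IsSPIL0 (Finset.range (ℓ + 1)) L.toFinset := by
  obtain ⟨hnd, hdis⟩ := (nodup_flatten_natAbs L).mp h.nodup
  refine ⟨?_, ?_, ?_⟩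
  · intro l hl
    rw [List.mem_toFinset] at hl
    refine ⟨h.ne l hl, ?_, hnd l hl, h.nonneg l hl, h.zero l hl⟩
    intro x hx
    rw [Finset.mem_range, ← h.mem]
    exact List.mem_map_of_mem (List.mem_flatten_of_mem hl hx)
  · intro l hl l' hl' hne
    rw [List.mem_toFinset] at hl hl'
    haveI : Std.Symm fun l l' : List ℤ =>
        Disjoint (l.map Int.natAbs).toFinset (l'.map Int.natAbs).toFinset :=
      ⟨fun _ _ hh => hh.symm⟩
    exact hdis.forall hl hl' hne
  · ext n
    rw [Finset.mem_range, ← h.mem]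
    simp only [Finset.mem_biUnion, List.mem_toFinset, List.mem_map, List.mem_flatten]
    constructor
    · rintro ⟨l, hl, x, hx, rfl⟩
      exact ⟨x, ⟨l, hl, hx⟩, rfl⟩
    · rintro ⟨x, ⟨l, hl, hx⟩, rfl⟩
      exact ⟨l, hl, x, hx, rfl⟩

lemma Good.nodupL {ℓ : ℕ} {L : List (List ℤ)} (h : Good ℓ L) : L.Nodup :=
  h.sorted.imp fun hlt heq => by rw [heq] at hlt; exact lt_irrefl _ hlt

lemma Good.inj {ℓ : ℕ} {L L' : List (List ℤ)} (h : Good ℓ L) (h' : Good ℓ L')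
    (heq : L.toFinset = L'.toFinset) : L = L' := by
  have hp : L.Perm L' := List.perm_of_nodup_nodup_toFinset_eq h.nodupL h'.nodupL heq
  exact hp.eq_of_pairwise (fun a b _ _ h1 h2 => absurd h1 (lt_asymm h2)) h.sorted h'.sorted

lemma exists_good {ℓ : ℕ} {P : Finset (List ℤ)} (hP : IsSPIL0 (Finset.range (ℓ + 1)) P) :
    ∃ L, Good ℓ L ∧ L.toFinset = P := by
  classical
  obtain ⟨h1, h2, h3⟩ := hP
  let r : List ℤ → List ℤ → Prop := fun l l' => lastD l' ≤ lastD l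
  let L := P.toList.insertionSort r
  have hperm : L.Perm P.toList := List.perm_insertionSort r _
  have hmem : ∀ l, l ∈ L ↔ l ∈ P := fun l => by rw [hperm.mem_iff, Finset.mem_toList]
  have hnodup : L.Nodup := hperm.nodup_iff.mpr P.nodup_toList
  haveI : Std.Total r := ⟨fun a b => le_total _ _⟩
  haveI : IsTrans (List ℤ) r := ⟨fun a b c hab hbc => le_trans hbc hab⟩
  have hsort : L.Pairwise r := List.pairwise_insertionSort r _
  have hne : ∀ l ∈ L, l ≠ [] := fun l hl => (h1 l ((hmem l).mp hl)).1
  have hdis : L.Pairwise fun l l' =>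
      Disjoint (l.map Int.natAbs).toFinset (l'.map Int.natAbs).toFinset := by
    refine List.Pairwise.imp_of_mem ?_ hnodup
    intro l l' hl hl' hll
    exact h2 l ((hmem l).mp hl) l' ((hmem l').mp hl') hll
  refine ⟨L, ⟨hne, ?_, ?_, ?_, ?_, ?_⟩, ?_⟩
  · refine List.Pairwise.imp_of_mem ?_ (hsort.and hdis)
    rintro l l' hl hl' ⟨hle, hd⟩
    refine lt_of_le_of_ne hle fun heq => ?_
    refine (Finset.disjoint_left.mp hd : ∀ ⦃a⦄, _ → _) (?_ : (lastD l).natAbs ∈ _) ?_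
    · rw [List.mem_toFinset]
      exact List.mem_map_of_mem (lastD_mem l (hne l hl))
    · rw [List.mem_toFinset, ← heq]
      exact List.mem_map_of_mem (lastD_mem l' (hne l' hl'))
  · rw [nodup_flatten_natAbs]
    exact ⟨fun l hl => (h1 l ((hmem l).mp hl)).2.2.1, hdis⟩
  · intro n
    rw [← Finset.mem_range, ← h3]
    simp only [Finset.mem_biUnion, List.mem_toFinset, List.mem_map, List.mem_flatten, hmem]
    constructor
    · rintro ⟨x, ⟨l, hl, hx⟩, rfl⟩
      exact ⟨l, hl, x, hx, rfl⟩
    · rintro ⟨l, hl, x, hx, rfl⟩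
      exact ⟨x, ⟨l, hl, hx⟩, rfl⟩
  · exact fun l hl => (h1 l ((hmem l).mp hl)).2.2.2.1
  · exact fun l hl => (h1 l ((hmem l).mp hl)).2.2.2.2
  · ext l
    rw [List.mem_toFinset, hmem]

/-! ### Data and words -/

/-- The marked word of a datum. -/
def wordOf (ℓ : ℕ) (d : (Fin ℓ → Fin (2 * ℓ + 1)) × (Fin ℓ → Bool)) : List (ℤ × Bool) :=
  List.ofFn (fun a => (((d.1 a : ℕ) : ℤ) - ℓ, d.2 a)) ++ [(0, true)]

lemma wordOf_inj (ℓ : ℕ) {d d' : (Fin ℓ → Fin (2 * ℓ + 1)) × (Fin ℓ → Bool)}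
    (h : wordOf ℓ d = wordOf ℓ d') : d = d' := by
  have h1 := List.ofFn_injective (List.append_cancel_right h)
  refine Prod.ext (funext fun a => ?_) (funext fun a => ?_)
  · have := congrArg Prod.fst (congrFun h1 a)
    simp only at this
    ext
    omega
  · exact congrArg Prod.snd (congrFun h1 a)

lemma good_of_datum {ℓ : ℕ} {d : (Fin ℓ → Fin (2 * ℓ + 1)) × (Fin ℓ → Bool)}
    (hd : IsDatum ℓ d) : ∃ L, Good ℓ L ∧ enc L = wordOf ℓ d := by
  obtain ⟨L, hL, henc⟩ := exists_enc (List.ofFn (fun a => (((d.1 a : ℕ) : ℤ) - ℓ, d.2 a)))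
  refine ⟨L, ?_, henc⟩
  have hflat : L.flatten = List.ofFn (fun a => ((d.1 a : ℕ) : ℤ) - ℓ) ++ [0] := by
    rw [← enc_fst, henc, List.map_append, List.map_ofFn]
    rfl
  have hlast := enc_filter L hL
  rw [henc] at hlast
  have hmid : ∀ a, ((d.1 a : ℕ) : ℤ) - ℓ ≠ 0 := by
    intro a h0
    apply hd.ne_rev a a
    symm
    rw [rev_eq_self_iff]
    ext
    simp only [mid]
    omega
  have hnd : (L.flatten.map Int.natAbs).Nodup := by
    rw [hflat, List.map_append, List.map_ofFn, List.nodup_append]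
    refine ⟨?_, by simp, ?_⟩
    · rw [List.nodup_ofFn]
      intro a a' haa
      simp only [Function.comp_apply] at haa
      by_contra hne
      rcases Int.natAbs_eq_natAbs_iff.mp haa with h | h
      · apply hne
        apply hd.inj
        ext
        omega
      · apply hd.ne_rev a a'
        ext
        rw [Fin.val_rev]
        omega
    · intro x hx y hy hxy
      simp only [List.map_cons, Int.natAbs_zero, List.map_nil, List.mem_singleton] at hy
      obtain ⟨a, rfl⟩ := List.mem_ofFn.mp hx
      simp only [Function.comp_apply] at hxy
      have := hmid a
      omega
  have hmark : ∀ x, x ∈ L.map lastD ↔ x = 0 ∨ ∃ a, d.2 a = true ∧ x = ((d.1 a : ℕ) : ℤ) - ℓ := by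
    intro x
    rw [← hlast]
    simp only [List.mem_map, List.mem_filter, List.mem_append, List.mem_ofFn, List.mem_singleton]
    constructor
    · rintro ⟨y, ⟨⟨a, rfl⟩ | rfl, hy⟩, rfl⟩
      · exact Or.inr ⟨a, hy, rfl⟩
      · exact Or.inl rfl
    · rintro (rfl | ⟨a, ha, rfl⟩)
      · exact ⟨(0, true), ⟨Or.inr rfl, rfl⟩, rfl⟩
      · exact ⟨_, ⟨Or.inl ⟨a, rfl⟩, ha⟩, rfl⟩
  have hpos : ∀ a, d.2 a = true → (0 : ℤ) < ((d.1 a : ℕ) : ℤ) - ℓ := by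
    intro a ha
    have := hd.mid_lt a ha
    rw [Fin.lt_def] at this
    simp only [mid] at this
    omega
  refine ⟨hL, ?_, hnd, ?_, ?_, ?_⟩
  · have key : (L.map lastD).Pairwise fun x y => y < x := by
      rw [← hlast, List.pairwise_map, List.pairwise_filter, List.pairwise_append]
      refine ⟨?_, by simp, ?_⟩
      · rw [List.pairwise_ofFn]
        intro a a' haa ha ha'
        have := hd.anti a a' haa ha ha'
        rw [Fin.lt_def] at this
        simp only
        omega
      · intro x hx y hy hx2 hy2
        obtain ⟨a, rfl⟩ := List.mem_ofFn.mp hx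
        rw [List.mem_singleton.mp hy]
        exact hpos a hx2
    rwa [List.pairwise_map] at key
  · have hsub : (L.flatten.map Int.natAbs).toFinset ⊆ Finset.range (ℓ + 1) := by
      intro n hn
      rw [List.mem_toFinset, hflat] at hn
      simp only [List.mem_map, List.mem_append, List.mem_ofFn, List.mem_singleton] at hn
      rw [Finset.mem_range]
      rcases hn with ⟨x, ⟨a, rfl⟩ | rfl, rfl⟩
      · have := (d.1 a).isLt
        omega
      · simp
    have hcard : (L.flatten.map Int.natAbs).toFinset.card = ℓ + 1 := by
      rw [List.toFinset_card_of_nodup hnd, hflat]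
      simp
    have heq := Finset.eq_of_subset_of_card_le hsub (by rw [hcard, Finset.card_range])
    intro n
    rw [← List.mem_toFinset, heq, Finset.mem_range]
  · intro l hl
    rcases (hmark _).mp (List.mem_map_of_mem hl) with h | ⟨a, ha, h⟩
    · rw [h]
    · rw [h]
      exact (hpos a ha).le
  · intro l hl h0
    obtain ⟨l', hl', hl0⟩ := List.mem_map.mp ((hmark 0).mpr (Or.inl rfl))
    by_cases hne : l = l'
    · rw [hne, hl0]
    · exfalso
      have hdis := ((nodup_flatten_natAbs L).mp hnd).2
      haveI : Std.Symm fun l l' : List ℤ =>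
          Disjoint (l.map Int.natAbs).toFinset (l'.map Int.natAbs).toFinset :=
        ⟨fun _ _ hh => hh.symm⟩
      have hd' := hdis.forall hl hl' hne
      refine (Finset.disjoint_left.mp hd' : ∀ ⦃a⦄, _ → _) (?_ : Int.natAbs 0 ∈ _) ?_
      · rw [List.mem_toFinset]
        exact List.mem_map_of_mem h0
      · rw [List.mem_toFinset]
        refine List.mem_map_of_mem ?_
        have := lastD_mem l' (hL l' hl')
        rwa [hl0] at this

lemma datum_of_good {ℓ : ℕ} {L : List (List ℤ)} (h : Good ℓ L) :
    ∃ d, IsDatum ℓ d ∧ enc L = wordOf ℓ d := by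
  -- the word ends with a marked zero
  have hX : ∃ X, enc L = X ++ [(0, true)] := by
    have h0 : (0 : ℕ) ∈ L.flatten.map Int.natAbs := (h.mem 0).mpr (Nat.succ_pos _)
    obtain ⟨x, hx, hx0⟩ := List.mem_map.mp h0
    rw [Int.natAbs_eq_zero] at hx0
    subst hx0
    obtain ⟨l, hl, h0l⟩ := List.mem_flatten.mp hx
    have hl0 := h.zero l hl h0l
    rcases List.eq_nil_or_concat L with hnil | ⟨T, m, hT⟩
    · rw [hnil] at hl
      simp at hl
    · rw [List.concat_eq_append] at hT
      have hm : m ∈ L := by rw [hT]; simp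
      have hm0 : lastD m = 0 := by
        have hs := h.sorted
        have hl2 := hl
        rw [hT, List.pairwise_append] at hs
        rw [hT, List.mem_append] at hl2
        rcases hl2 with hl2 | hl2
        · have h1 := hs.2.2 l hl2 m (by simp)
          have h2 := h.nonneg m hm
          omega
        · rw [← List.mem_singleton.mp hl2, hl0]
      obtain ⟨Y, hY⟩ := enc1_split m (h.ne m hm)
      refine ⟨enc T ++ Y.map (fun x => (x, false)), ?_⟩
      rw [hT, List.append_assoc, ← hm0, ← hY]
      simp [enc]
  obtain ⟨X, hX⟩ := hX
  have hflat : L.flatten = X.map Prod.fst ++ [0] := by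
    rw [← enc_fst, hX, List.map_append]
    rfl
  have hset : (L.flatten.map Int.natAbs).toFinset = Finset.range (ℓ + 1) := by
    ext n
    rw [List.mem_toFinset, h.mem, Finset.mem_range]
  have hlen : X.length = ℓ := by
    have h1 := List.toFinset_card_of_nodup h.nodup
    rw [hset, hflat] at h1
    simp at h1
    omega
  obtain ⟨v, rfl⟩ : ∃ v : Fin ℓ → ℤ × Bool, X = List.ofFn v := by
    subst hlen
    exact ⟨X.get, (List.ofFn_get X).symm⟩
  have hbd : ∀ a, (v a).1.natAbs < ℓ + 1 := by
    intro a
    rw [← h.mem, hflat]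
    refine List.mem_map_of_mem (List.mem_append_left _ (List.mem_map_of_mem ?_))
    exact List.mem_ofFn.mpr ⟨a, rfl⟩
  have hnd := h.nodup
  rw [hflat, List.map_append, List.map_ofFn, List.map_ofFn, List.nodup_append,
    List.nodup_ofFn] at hnd
  obtain ⟨hinj, -, hne0⟩ := hnd
  have hv0 : ∀ a, (v a).1.natAbs ≠ 0 := fun a =>
    hne0 _ (List.mem_ofFn.mpr ⟨a, rfl⟩) 0 (by simp)
  have hlast := enc_filter L h.ne
  have hmark : ∀ a, (v a).2 = true → 0 ≤ (v a).1 := by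
    intro a ha
    have : (v a).1 ∈ L.map lastD := by
      rw [← hlast, hX]
      refine List.mem_map_of_mem (List.mem_filter.mpr ⟨List.mem_append_left _ ?_, ha⟩)
      exact List.mem_ofFn.mpr ⟨a, rfl⟩
    obtain ⟨l, hl, hl'⟩ := List.mem_map.mp this
    rw [← hl']
    exact h.nonneg l hl
  have hsort : ∀ a a', a < a' → (v a).2 = true → (v a').2 = true → (v a').1 < (v a).1 := by
    have key : (L.map lastD).Pairwise fun x y => y < x := by
      rw [List.pairwise_map]
      exact h.sorted
    rw [← hlast, hX, List.pairwise_map, List.pairwise_filter, List.pairwise_append,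
      List.pairwise_ofFn] at key
    intro a a' haa ha ha'
    exact key.1 haa ha ha'
  let p : Fin ℓ → Fin (2 * ℓ + 1) := fun a =>
    ⟨((v a).1 + ℓ).toNat, by have := hbd a; omega⟩
  have hp : ∀ a, ((p a : ℕ) : ℤ) = (v a).1 + ℓ := by
    intro a
    have := hbd a
    simp only [p]
    omega
  refine ⟨(p, fun a => (v a).2), ⟨?_, ?_, ?_, ?_⟩, ?_⟩
  · intro a a' haa
    apply hinj
    have h1 := hp a
    have h2 := hp a'
    simp only at haa
    rw [haa] at h1
    simp only [Function.comp_apply]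
    omega
  · intro a a' haa
    have h1 := hp a
    have h2 := hp a'
    have h3 := hv0 a
    simp only at haa
    have h4 := congrArg Fin.val haa
    rw [Fin.val_rev] at h4
    have h5 : a = a' := by
      apply hinj
      simp only [Function.comp_apply]
      omega
    subst h5
    omega
  · intro a ha
    have h1 := hp a
    have h2 := hmark a ha
    have h3 := hv0 a
    rw [Fin.lt_def]
    simp only [mid]
    omega
  · intro a a' haa ha ha'
    have h1 := hp a
    have h2 := hp a'
    have h3 := hsort a a' haa ha ha'
    rw [Fin.lt_def]
    simp only
    omega
  · rw [hX, wordOf]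
    congr 2
    funext a
    refine Prod.ext ?_ rfl
    simp only [hp]
    omega

lemma card_datum (ℓ : ℕ) : Nat.card {d // IsDatum ℓ d} = spil0Count ℓ := by
  have hex : ∀ d : {d // IsDatum ℓ d}, ∃ L, Good ℓ L ∧ enc L = wordOf ℓ d.1 :=
    fun d => good_of_datum d.2
  choose f hf hfe using hex
  unfold spil0Count
  rw [← Nat.card_coe_set_eq]
  refine Nat.card_congr (Equiv.ofBijective
    (fun d => (⟨(f d).toFinset, (hf d).isSPIL⟩ :
      {P : Finset (List ℤ) | IsSPIL0 (Finset.range (ℓ + 1)) P})) ⟨?_, ?_⟩)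
  · intro d d' h
    have h1 := (hf d).inj (hf d') (congrArg Subtype.val h)
    apply Subtype.ext
    apply wordOf_inj
    rw [← hfe, ← hfe, h1]
  · rintro ⟨P, hP⟩
    obtain ⟨L, hL, hLP⟩ := exists_good hP
    obtain ⟨d, hd, hde⟩ := datum_of_good hL
    refine ⟨⟨d, hd⟩, Subtype.ext ?_⟩
    have h1 : f ⟨d, hd⟩ = L := enc_inj _ _ (hf _).ne hL.ne (by rw [hfe, hde])
    simp only [h1, hLP]

/-- The number of `B_{SO(2ℓ)}`-orbits on the set of maximal isotropic
flags in `ℂ^{2ℓ+1}` equals `|SPIL(ℓ ∪ {0})|`. -/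
theorem statement2 (ℓ : ℕ) (hl : 1 ≤ ℓ) :
    Nat.card (Quot (flagBRel ℓ)) = spil0Count ℓ := by
  rw [card_quot, card_datum]

end
end

section
/- For every ℓ ≥ 1, the number of signed partitions into lists of {1,…,ℓ} satisfies |SPIL(ℓ)| = ∑_{k=1}^{ℓ} 2^{ℓ−k}·(ℓ!/k!)·C(ℓ−1,k−1), i.e. |SPIL(ℓ)| equals the sum over k of 2^{ℓ−k} times the Lah number L(ℓ,k). -/
open scoped BigOperators

noncomputable section

/-- A signed list on the finite set `A` of positive integers: a nonempty finite sequence of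
nonzero integers whose absolute values are pairwise distinct and lie in `A`, and whose last
entry is positive. -/
def IsSignedList (A : Finset ℕ) (l : List ℤ) : Prop :=
  l ≠ [] ∧ (∀ x ∈ l, x ≠ 0 ∧ x.natAbs ∈ A) ∧ (l.map Int.natAbs).Nodup ∧
    0 < l.getLastD 0

/-- `P` is a signed partition into lists (SPIL) of the finite set `A` of positive integers. -/
def IsSPIL (A : Finset ℕ) (P : Finset (List ℤ)) : Prop :=
  (∀ l ∈ P, IsSignedList A l) ∧
  (∀ l ∈ P, ∀ l' ∈ P, l ≠ l' →
    Disjoint (l.map Int.natAbs).toFinset (l'.map Int.natAbs).toFinset) ∧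
  P.biUnion (fun l => (l.map Int.natAbs).toFinset) = A

/-- `|SPIL(ℓ)|`: the number of signed partitions into lists of `{1, …, ℓ}`. -/
def spilCount (ℓ : ℕ) : ℕ := Set.ncard {P : Finset (List ℤ) | IsSPIL (Finset.Icc 1 ℓ) P}

def consHead (x : ℤ) : List (List ℤ) → List (List ℤ)
  | [] => []
  | l :: r => (x :: l) :: r

lemma consHead_inj (x : ℤ) : Function.Injective (consHead x) := by
  intro a b h
  cases a <;> cases b <;> simp_all [consHead]

def ordSpil : ℕ → Finset ℕ → ℕ → Finset (List (List ℤ))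
  | 0, _, 0 => {[]}
  | 0, _, _ + 1 => ∅
  | _ + 1, _, 0 => ∅
  | n + 1, A, k + 1 => A.biUnion fun x =>
      ((ordSpil n (A.erase x) k).image (fun Q => [(x : ℤ)] :: Q) ∪
        (ordSpil n (A.erase x) (k + 1)).image (consHead (x : ℤ))) ∪
        (ordSpil n (A.erase x) (k + 1)).image (consHead (-(x : ℤ)))

def Good_s7 (A : Finset ℕ) (Q : List (List ℤ)) : Prop :=
  (∀ l ∈ Q, l ≠ [] ∧ 0 < l.getLastD 0) ∧ (Q.flatten.map Int.natAbs).Nodup ∧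
    ∀ a, a ∈ Q.flatten.map Int.natAbs ↔ a ∈ A

lemma good_single (A : Finset ℕ) (x : ℤ) (hx : x.natAbs ∈ A) (Q : List (List ℤ)) :
    Good_s7 A ([x] :: Q) ↔ 0 < x ∧ Good_s7 (A.erase x.natAbs) Q := by
  unfold Good_s7
  simp only [List.mem_cons, forall_eq_or_imp, List.flatten_cons, List.singleton_append,
    List.map_cons, List.nodup_cons, Finset.mem_erase]
  constructor
  · rintro ⟨⟨⟨_, h1⟩, h2⟩, ⟨h3, h4⟩, h5⟩
    refine ⟨by simpa using h1, h2, h4, fun a => ?_⟩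
    have := h5 a
    constructor
    · intro ha
      exact ⟨fun e => h3 (e ▸ ha), this.1 (Or.inr ha)⟩
    · rintro ⟨ha, hb⟩
      exact (this.2 hb).resolve_left ha
  · rintro ⟨h1, h2, h4, h5⟩
    refine ⟨⟨⟨by simp, by simpa using h1⟩, h2⟩, ⟨fun h => ((h5 _).1 h).1 rfl, h4⟩, fun a => ?_⟩
    rw [h5]
    by_cases e : a = x.natAbs
    · simp [e, hx]
    · simp [e]

lemma good_cons (A : Finset ℕ) (x : ℤ) (hx : x.natAbs ∈ A) (l : List ℤ) (hl : l ≠ [])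
    (Q : List (List ℤ)) :
    Good_s7 A ((x :: l) :: Q) ↔ Good_s7 (A.erase x.natAbs) (l :: Q) := by
  have hlast : (x :: l).getLastD 0 = l.getLastD 0 := by
    cases l with
    | nil => exact absurd rfl hl
    | cons a l => simp
  unfold Good_s7
  simp only [List.mem_cons, forall_eq_or_imp, List.flatten_cons, List.cons_append,
    List.map_cons, List.nodup_cons, Finset.mem_erase, hlast]
  constructor
  · rintro ⟨⟨⟨_, h1⟩, h2⟩, ⟨h3, h4⟩, h5⟩
    refine ⟨⟨⟨hl, h1⟩, h2⟩, h4, fun a => ?_⟩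
    have := h5 a
    constructor
    · intro ha
      exact ⟨fun e => h3 (e ▸ ha), this.1 (Or.inr ha)⟩
    · rintro ⟨ha, hb⟩
      exact (this.2 hb).resolve_left ha
  · rintro ⟨⟨⟨_, h1⟩, h2⟩, h4, h5⟩
    refine ⟨⟨⟨by simp, h1⟩, h2⟩, ⟨fun h => ((h5 _).1 h).1 rfl, h4⟩, fun a => ?_⟩
    rw [h5]
    by_cases e : a = x.natAbs
    · simp [e, hx]
    · simp [e]

lemma mem_ordSpil (n : ℕ) : ∀ (A : Finset ℕ) (k : ℕ) (Q : List (List ℤ)), A.card = n → 0 ∉ A →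
    (Q ∈ ordSpil n A k ↔ Q.length = k ∧ Good_s7 A Q) := by
  induction n with
  | zero =>
    intro A k Q hA h0
    rw [Finset.card_eq_zero] at hA
    subst hA
    have key : Good_s7 ∅ Q ↔ Q = [] := by
      constructor
      · rintro ⟨h1, -, h3⟩
        cases Q with
        | nil => rfl
        | cons l r =>
          exfalso
          have hl := (h1 l (by simp)).1
          obtain ⟨a, ha⟩ := List.exists_mem_of_ne_nil l hl
          have := (h3 a.natAbs).1 (List.mem_map_of_mem (by simp [ha]))
          simp at this
      · rintro rfl
        simp [Good_s7]
    rw [key]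
    cases k with
    | zero => simp [ordSpil]
    | succ k =>
      simp only [ordSpil, Finset.notMem_empty, false_iff]
      rintro ⟨h, rfl⟩
      simp at h
  | succ n ih =>
    intro A k Q hA h0
    cases k with
    | zero =>
      simp only [ordSpil, Finset.notMem_empty, false_iff]
      rintro ⟨h, hg⟩
      obtain rfl := List.length_eq_zero_iff.1 h
      have hne : A.Nonempty := by rw [← Finset.card_pos]; omega
      obtain ⟨a, ha⟩ := hne
      have := (hg.2.2 a).2 ha
      simp at this
    | succ k =>
      have ih' : ∀ x ∈ A, ∀ k Q, (Q ∈ ordSpil n (A.erase x) k ↔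
          Q.length = k ∧ Good_s7 (A.erase x) Q) := by
        intro x hx k Q
        exact ih _ _ _ (by rw [Finset.card_erase_of_mem hx]; omega)
          (fun h => h0 (Finset.mem_of_mem_erase h))
      simp only [ordSpil, Finset.mem_biUnion, Finset.mem_union, Finset.mem_image]
      constructor
      · rintro ⟨x, hx, (⟨Q', hQ, rfl⟩ | ⟨Q', hQ, rfl⟩) | ⟨Q', hQ, rfl⟩⟩
        · rw [ih' x hx] at hQ
          refine ⟨by simp [hQ.1], ?_⟩
          rw [good_single _ _ (by simpa using hx)]
          refine ⟨?_, by simpa using hQ.2⟩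
          have : x ≠ 0 := fun e => h0 (e ▸ hx)
          omega
        · rw [ih' x hx] at hQ
          cases Q' with
          | nil => simp at hQ
          | cons l r =>
            refine ⟨by simpa [consHead] using hQ.1, ?_⟩
            simp only [consHead]
            rw [good_cons _ _ (by simpa using hx) _ (hQ.2.1 l (by simp)).1]
            simpa using hQ.2
        · rw [ih' x hx] at hQ
          cases Q' with
          | nil => simp at hQ
          | cons l r =>
            refine ⟨by simpa [consHead] using hQ.1, ?_⟩
            simp only [consHead]
            rw [good_cons _ _ (by simpa using hx) _ (hQ.2.1 l (by simp)).1]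
            simpa using hQ.2
      · rintro ⟨hlen, hg⟩
        cases Q with
        | nil => simp at hlen
        | cons l r =>
          cases l with
          | nil => exact absurd rfl (hg.1 [] (by simp)).1
          | cons x l =>
            have hx : x.natAbs ∈ A := (hg.2.2 _).1 (by simp)
            refine ⟨x.natAbs, hx, ?_⟩
            by_cases hl : l = []
            · subst hl
              rw [good_single _ _ hx] at hg
              refine Or.inl (Or.inl ⟨r, (ih' _ hx _ _).2 ⟨by simpa using hlen, hg.2⟩, ?_⟩)
              have : (x.natAbs : ℤ) = x := by omega
              rw [this]
            · rw [good_cons _ _ hx _ hl] at hg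
              have hm : (l :: r) ∈ ordSpil n (A.erase x.natAbs) (k + 1) :=
                (ih' _ hx _ _).2 ⟨by simpa using hlen, hg⟩
              rcases Int.natAbs_eq x with h | h
              · refine Or.inl (Or.inr ⟨_, hm, ?_⟩)
                simp only [consHead]
                rw [← h]
              · refine Or.inr ⟨_, hm, ?_⟩
                simp only [consHead]
                rw [← h]

lemma card_step (n k : ℕ) (A : Finset ℕ) (hA : A.card = n + 1) (h0 : 0 ∉ A) :
    (ordSpil (n + 1) A (k + 1)).card =
      ∑ x ∈ A, ((ordSpil n (A.erase x) k).card + 2 * (ordSpil n (A.erase x) (k + 1)).card) := by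
  have hne : ∀ x ∈ A, ∀ Q ∈ ordSpil n (A.erase x) (k + 1), ∃ a l r, Q = (a :: l) :: r := by
    intro x hx Q hQ
    rw [mem_ordSpil n _ _ _ (by rw [Finset.card_erase_of_mem hx]; omega)
          (fun h => h0 (Finset.mem_of_mem_erase h))] at hQ
    cases Q with
    | nil => simp at hQ
    | cons l r =>
      cases l with
      | nil => exact absurd rfl (hQ.2.1 [] (by simp)).1
      | cons a l => exact ⟨a, l, r, rfl⟩
  rw [ordSpil, Finset.card_biUnion]
  · refine Finset.sum_congr rfl fun x hx => ?_
    have hx0 : x ≠ 0 := fun e => h0 (e ▸ hx)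
    rw [Finset.card_union_of_disjoint, Finset.card_union_of_disjoint,
      Finset.card_image_of_injective _ (consHead_inj _),
      Finset.card_image_of_injective _ (consHead_inj _), Finset.card_image_of_injective]
    · ring
    · intro a b h
      simpa using h
    · rw [Finset.disjoint_left]
      intro Q h1 h2
      simp only [Finset.mem_image] at h1 h2
      obtain ⟨Q1, h1, rfl⟩ := h1
      obtain ⟨Q2, h2, h3⟩ := h2
      obtain ⟨a, l, r, rfl⟩ := hne x hx _ h2
      simp [consHead] at h3
    · rw [Finset.disjoint_left]
      intro Q h1 h2
      simp only [Finset.mem_image, Finset.mem_union] at h1 h2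
      obtain ⟨Q2, h2, rfl⟩ := h2
      obtain ⟨a, l, r, rfl⟩ := hne x hx _ h2
      rcases h1 with ⟨Q1, h1, h3⟩ | ⟨Q1, h1, h3⟩
      · simp [consHead] at h3
      · obtain ⟨a', l', r', rfl⟩ := hne x hx _ h1
        simp only [consHead, List.cons.injEq] at h3
        omega
  · have hd : ∀ x ∈ A, ∀ Q ∈ ((ordSpil n (A.erase x) k).image (fun Q => [(x : ℤ)] :: Q) ∪
        (ordSpil n (A.erase x) (k + 1)).image (consHead (x : ℤ))) ∪
        (ordSpil n (A.erase x) (k + 1)).image (consHead (-(x : ℤ))),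
        (Q.flatten.headD 0).natAbs = x := by
      intro x hx Q hQ
      simp only [Finset.mem_union, Finset.mem_image] at hQ
      rcases hQ with (⟨Q', hQ, rfl⟩ | ⟨Q', hQ, rfl⟩) | ⟨Q', hQ, rfl⟩
      · simp
      · obtain ⟨a, l, r, rfl⟩ := hne x hx _ hQ
        simp [consHead]
      · obtain ⟨a, l, r, rfl⟩ := hne x hx _ hQ
        simp [consHead]
    intro x hx y hy hxy
    refine Finset.disjoint_left.2 fun Q h1 h2 => hxy ?_
    rw [← hd x hx Q h1, ← hd y hy Q h2]

lemma card_ordSpil (n : ℕ) : ∀ (k : ℕ) (A : Finset ℕ), A.card = n + 1 → 0 ∉ A →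
    (ordSpil (n + 1) A (k + 1)).card = (n + 1).factorial * (2 ^ (n - k) * n.choose k) := by
  induction n with
  | zero =>
    intro k A hA h0
    rw [card_step 0 k A hA h0]
    cases k with
    | zero => simp [ordSpil, hA]
    | succ k => simp [ordSpil]
  | succ n ih =>
    intro k A hA h0
    rw [card_step _ k A hA h0]
    have e1 : ∀ x ∈ A, ∀ k, (ordSpil (n + 1) (A.erase x) (k + 1)).card
        = (n + 1).factorial * (2 ^ (n - k) * n.choose k) := fun x hx k =>
      ih k _ (by rw [Finset.card_erase_of_mem hx]; omega)
        (fun h => h0 (Finset.mem_of_mem_erase h))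
    cases k with
    | zero =>
      rw [Finset.sum_congr rfl (fun x hx => by rw [e1 x hx 0])]
      simp only [ordSpil, Finset.sum_const, hA, Finset.card_empty, smul_eq_mul,
        Nat.choose_zero_right, Nat.sub_zero]
      rw [Nat.factorial_succ (n + 1), pow_succ]
      ring
    | succ k =>
      rw [Finset.sum_congr rfl (fun x hx => by rw [e1 x hx (k + 1), e1 x hx k])]
      simp only [Finset.sum_const, hA, smul_eq_mul]
      rw [Nat.factorial_succ (n + 1), Nat.choose_succ_succ, Nat.add_sub_add_right]
      rcases Nat.lt_or_ge k n with h | h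
      · have : n - k = (n - (k + 1)) + 1 := by omega
        rw [this, pow_succ]
        ring
      · rw [Nat.choose_eq_zero_of_lt (show n < k + 1 by omega)]
        ring

lemma good_iff (A : Finset ℕ) (h0 : 0 ∉ A) (Q : List (List ℤ)) :
    Good_s7 A Q ↔ Q.Nodup ∧ IsSPIL A Q.toFinset := by
  unfold Good_s7 IsSPIL IsSignedList
  simp only [List.mem_toFinset, List.map_flatten, List.nodup_flatten, List.mem_map,
    forall_exists_index, and_imp, forall_apply_eq_imp_iff₂, List.pairwise_map, Finset.ext_iff,
    Finset.mem_biUnion, List.mem_flatten, exists_exists_and_eq_and]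
  have hdis : ∀ l l' : List ℤ, Disjoint (l.map Int.natAbs).toFinset (l'.map Int.natAbs).toFinset ↔
      List.Disjoint (l.map Int.natAbs) (l'.map Int.natAbs) := by
    intro l l'
    rw [List.disjoint_toFinset_iff_disjoint]
  simp only [hdis]
  constructor
  · rintro ⟨h1, ⟨h2, h3⟩, h4⟩
    have hnd : Q.Nodup := by
      refine List.Pairwise.imp_of_mem ?_ h3
      rintro a b ha hb hab rfl
      obtain ⟨x, hx⟩ := List.exists_mem_of_ne_nil a (h1 a ha).1
      exact hab (List.mem_map_of_mem hx) (List.mem_map_of_mem hx)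
    refine ⟨hnd, fun l hl => ⟨(h1 l hl).1, fun x hx => ?_, h2 l hl, (h1 l hl).2⟩, ?_, h4⟩
    · have hm : x.natAbs ∈ A := (h4 _).1 ⟨l, hl, x, hx, rfl⟩
      refine ⟨?_, hm⟩
      rintro rfl
      exact h0 hm
    · intro l hl l' hl' hne
      have : Std.Symm fun a b : List ℤ =>
          (List.map Int.natAbs a).Disjoint (List.map Int.natAbs b) := ⟨fun _ _ h => h.symm⟩
      exact h3.forall hl hl' hne
  · rintro ⟨hnd, h1, h2, h3⟩
    refine ⟨fun l hl => ⟨(h1 l hl).1, (h1 l hl).2.2.2⟩, ⟨fun l hl => (h1 l hl).2.2.1, ?_⟩, h3⟩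
    exact List.Pairwise.imp_of_mem (fun ha hb hab => h2 _ ha _ hb hab) hnd

lemma card_image_mul (n k : ℕ) (A : Finset ℕ) (hA : A.card = n) (h0 : 0 ∉ A) :
    (ordSpil n A k).card = ((ordSpil n A k).image List.toFinset).card * k.factorial := by
  rw [Finset.card_eq_sum_card_image List.toFinset (ordSpil n A k)]
  rw [Finset.sum_const_nat]
  intro P hP
  obtain ⟨Q, hQ, rfl⟩ := Finset.mem_image.1 hP
  rw [mem_ordSpil n A k Q hA h0, good_iff A h0] at hQ
  obtain ⟨hlen, hnd, hs⟩ := hQ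
  have : (ordSpil n A k).filter (fun R => R.toFinset = Q.toFinset) = Q.permutations.toFinset := by
    ext R
    rw [Finset.mem_filter, List.mem_toFinset, List.mem_permutations,
      mem_ordSpil n A k R hA h0, good_iff A h0]
    constructor
    · rintro ⟨⟨_, h, _⟩, e⟩
      exact List.perm_of_nodup_nodup_toFinset_eq h hnd e
    · intro h
      have e := List.toFinset_eq_of_perm _ _ h
      exact ⟨⟨h.length_eq.trans hlen, h.nodup_iff.2 hnd, e ▸ hs⟩, e⟩
  rw [this, List.toFinset_card_of_nodup (List.nodup_permutations _ hnd),
    List.length_permutations, hlen]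

/-- `|SPIL(ℓ)| = ∑_{k=1}^{ℓ} 2^{ℓ-k} · (ℓ!/k!) · C(ℓ-1, k-1)`. -/
theorem statement7 (ℓ : ℕ) (hl : 1 ≤ ℓ) :
    spilCount ℓ =
      ∑ k ∈ Finset.Icc 1 ℓ,
        2 ^ (ℓ - k) * ((ℓ.factorial / k.factorial) * (ℓ - 1).choose (k - 1)) := by
  have h0 : 0 ∉ Finset.Icc 1 ℓ := by simp
  have hA : (Finset.Icc 1 ℓ).card = ℓ := by simp
  obtain ⟨n, rfl⟩ : ∃ n, ℓ = n + 1 := ⟨ℓ - 1, by omega⟩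
  generalize hAA : Finset.Icc 1 (n + 1) = A at h0 hA
  have hmem : ∀ k P, P ∈ (ordSpil (n + 1) A k).image List.toFinset ↔
      P.card = k ∧ IsSPIL A P := by
    intro k P
    simp only [Finset.mem_image, mem_ordSpil (n + 1) A k _ hA h0, good_iff A h0]
    constructor
    · rintro ⟨Q, ⟨h1, h2, h3⟩, rfl⟩
      exact ⟨by rw [List.toFinset_card_of_nodup h2, h1], h3⟩
    · rintro ⟨h1, h2⟩
      exact ⟨P.toList, ⟨by simpa using h1, P.nodup_toList, by simpa using h2⟩, by simp⟩
  have hset : {P : Finset (List ℤ) | IsSPIL A P} =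
      ((Finset.Icc 1 (n + 1)).biUnion fun k => (ordSpil (n + 1) A k).image List.toFinset :
        Finset (Finset (List ℤ))) := by
    ext P
    simp only [Set.mem_ofPred_eq, Finset.coe_biUnion, Set.mem_iUnion, Finset.mem_coe, hmem]
    constructor
    · intro h
      refine ⟨P.card, ?_, rfl, h⟩
      have hP := (hmem P.card P).2 ⟨rfl, h⟩
      obtain ⟨Q, hQ, -⟩ := Finset.mem_image.1 hP
      have hpos := Finset.card_pos.2 ⟨Q, hQ⟩
      rcases hc : P.card with _ | c
      · rw [hc] at hpos
        simp [ordSpil] at hpos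
      · rw [hc, card_ordSpil n c A hA h0] at hpos
        have : c ≤ n := by
          by_contra hlt
          rw [Nat.choose_eq_zero_of_lt (by omega)] at hpos
          simp at hpos
        simp [this]
    · rintro ⟨k, -, -, h⟩
      exact h
  unfold spilCount
  rw [hAA, hset, Set.ncard_coe_finset, Finset.card_biUnion, hAA]
  · rw [← hAA]
    refine Finset.sum_congr rfl fun k hk => ?_
    obtain ⟨hk1, hk2⟩ := Finset.mem_Icc.1 hk
    obtain ⟨c, rfl⟩ : ∃ c, k = c + 1 := ⟨k - 1, by omega⟩
    rw [hAA]
    have h1 := card_image_mul (n + 1) (c + 1) A hA h0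
    rw [card_ordSpil n c A hA h0] at h1
    refine Nat.eq_of_mul_eq_mul_right (Nat.factorial_pos (c + 1)) ?_
    rw [← h1, Nat.add_sub_add_right, Nat.add_sub_cancel, Nat.add_sub_cancel]
    obtain ⟨d, hd⟩ := Nat.factorial_dvd_factorial hk2
    rw [hd, Nat.mul_div_cancel_left _ (Nat.factorial_pos _)]
    ring
  · intro j _ k _ hjk
    refine Finset.disjoint_left.2 fun P h1 h2 => hjk ?_
    rw [← ((hmem _ _).1 h1).1, ← ((hmem _ _).1 h2).1]

end
end

section
/- For every ℓ ≥ 1, the number of signed partitions into lists of {0,1,…,ℓ} satisfies |SPIL(ℓ∪{0})| = ∑_{k=1}^{ℓ+1} (ℓ!/(k−1)!)·C(ℓ,k−1)·2^{ℓ−k+1}. -/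
open scoped BigOperators

noncomputable section

/-- Prefix functions: each `e ∈ E` gets a list `f e`, all absolute values together being `M`. -/
def PGood (E M : Finset ℕ) (f : ℕ → List ℤ) : Prop :=
  (∀ e, e ∉ E → f e = []) ∧ ∑ e ∈ E, (((f e).map Int.natAbs : List ℕ) : Multiset ℕ) = M.val

def sgn (b : Bool) (a : ℕ) : ℤ := if b then (a : ℤ) else -(a : ℤ)

lemma sgn_natAbs (b : Bool) (a : ℕ) : (sgn b a).natAbs = a := by
  unfold sgn; split <;> simp

lemma exists_sgn (x : ℤ) : ∃ b, sgn b x.natAbs = x := by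
  rcases Int.natAbs_eq x with h | h
  · exact ⟨true, by simp only [sgn]; simpa using h.symm⟩
  · exact ⟨false, by simp only [sgn]; simpa using h.symm⟩

lemma sgn_inj {b b' : Bool} {a a' : ℕ} (ha : a ≠ 0) (h : sgn b a = sgn b' a') :
    a = a' ∧ b = b' := by
  have h1 : a = a' := by rw [← sgn_natAbs b a, h, sgn_natAbs]
  subst h1
  refine ⟨rfl, ?_⟩
  cases b <;> cases b' <;> simp_all [sgn]

lemma sum_update (E : Finset ℕ) (e : ℕ) (he : e ∉ E) (f : ℕ → List ℤ) (l : List ℤ) :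
    ∑ i ∈ insert e E, (((Function.update f e l i).map Int.natAbs : List ℕ) : Multiset ℕ)
      = ((l.map Int.natAbs : List ℕ) : Multiset ℕ) +
        ∑ i ∈ E, (((f i).map Int.natAbs : List ℕ) : Multiset ℕ) := by
  rw [Finset.sum_insert he, Function.update_self]
  congr 1
  refine Finset.sum_congr rfl fun i hi => ?_
  rw [Function.update_of_ne]
  rintro rfl; exact he hi

lemma exists_count (E : Finset ℕ) : ∀ (m : ℕ) (M : Finset ℕ), M.card = m → 0 ∉ M →
    ∃ F : Finset (ℕ → List ℤ), (∀ f, f ∈ F ↔ PGood E M f) ∧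
      F.card = 2 ^ m * E.card.ascFactorial m := by
  classical
  induction E using Finset.induction_on with
  | empty =>
    intro m M hM h0
    rcases m with _ | m
    · rw [Finset.card_eq_zero] at hM
      subst hM
      refine ⟨{fun _ => []}, fun f => ?_, by simp⟩
      simp [PGood, funext_iff]
    · refine ⟨∅, fun f => ?_, by simp [Nat.zero_ascFactorial]⟩
      simp only [PGood, Finset.notMem_empty, false_iff, Finset.sum_empty, not_and]
      intro _ h
      have : M.card = 0 := by rw [Finset.card_def, ← h]; rfl
      omega
  | insert e E he ihE =>
    intro m
    induction m with
    | zero =>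
      intro M hM h0
      obtain ⟨F, hF, hc⟩ := ihE 0 M hM h0
      refine ⟨F, fun f => ?_, by rw [hc]; simp⟩
      rw [hF]
      rw [Finset.card_eq_zero] at hM
      subst hM
      simp only [PGood, Finset.empty_val]
      constructor
      · rintro ⟨h1, h2⟩
        refine ⟨fun i hi => h1 i (by simp_all), ?_⟩
        rw [Finset.sum_insert he, h1 e he, h2]; simp
      · rintro ⟨h1, h2⟩
        rw [Finset.sum_insert he, add_eq_zero] at h2
        refine ⟨fun i hi => ?_, h2.2⟩
        by_cases hie : i = e
        · subst hie; simpa using h2.1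
        · exact h1 i (by simp_all)
    | succ m ihm =>
      intro M hM h0
      obtain ⟨F, hF, hc⟩ := ihE (m+1) M hM h0
      have key : ∀ a : ℕ, ∃ G : Finset (ℕ → List ℤ), a ∈ M →
          (∀ f, f ∈ G ↔ PGood (insert e E) (M.erase a) f) ∧
          G.card = 2 ^ m * (insert e E).card.ascFactorial m := by
        intro a
        by_cases ha : a ∈ M
        · obtain ⟨G, hG⟩ := ihm (M.erase a) (by rw [Finset.card_erase_of_mem ha, hM]; rfl)
            (fun h => h0 (Finset.mem_of_mem_erase h))
          exact ⟨G, fun _ => hG⟩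
        · exact ⟨∅, fun h => absurd h ha⟩
      choose G hG using key
      let H : ℕ × Bool → Finset (ℕ → List ℤ) := fun p =>
        (G p.1).image (fun f => Function.update f e (sgn p.2 p.1 :: f e))
      have Hhead : ∀ p, ∀ f ∈ H p, ∃ t, f e = sgn p.2 p.1 :: t := by
        intro p f hf
        simp only [H, Finset.mem_image] at hf
        obtain ⟨g, _, rfl⟩ := hf
        exact ⟨g e, by simp⟩
      have Hcard : ∀ p ∈ M ×ˢ (Finset.univ : Finset Bool), (H p).card =
          2 ^ m * (insert e E).card.ascFactorial m := by
        intro p hp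
        rw [Finset.mem_product] at hp
        rw [← (hG p.1 hp.1).2]
        apply Finset.card_image_of_injective
        intro f g hfg
        funext i
        have := congrFun hfg i
        by_cases hi : i = e
        · subst hi; simpa using this
        · simpa [hi] using this
      refine ⟨F ∪ (M ×ˢ (Finset.univ : Finset Bool)).biUnion H, fun f => ?_, ?_⟩
      · simp only [Finset.mem_union, Finset.mem_biUnion, hF]
        constructor
        · rintro (⟨h1, h2⟩ | ⟨⟨a, b⟩, hp, hf⟩)
          · refine ⟨fun i hi => h1 i (by simp_all), ?_⟩
            rw [Finset.sum_insert he, h1 e he, h2]; simp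
          · simp only [Finset.mem_product, Finset.mem_univ, and_true] at hp
            simp only [H, Finset.mem_image] at hf
            obtain ⟨g, hg, rfl⟩ := hf
            rw [(hG a hp).1] at hg
            obtain ⟨h1, h2⟩ := hg
            refine ⟨fun i hi => ?_, ?_⟩
            · have : i ≠ e := by rintro rfl; simp at hi
              rw [Function.update_of_ne this, h1 i hi]
            · rw [sum_update _ _ he]
              rw [Finset.sum_insert he, Finset.erase_val] at h2
              rw [List.map_cons, ← Multiset.cons_coe, Multiset.cons_add, h2, sgn_natAbs,
                Multiset.cons_erase (by exact hp)]
        · rintro ⟨h1, h2⟩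
          rcases hfe : f e with _ | ⟨x, t⟩
          · left
            rw [Finset.sum_insert he, hfe] at h2
            refine ⟨fun i hi => ?_, by simpa using h2⟩
            by_cases hie : i = e
            · subst hie; exact hfe
            · exact h1 i (by simp_all)
          · right
            rw [Finset.sum_insert he, hfe, List.map_cons, ← Multiset.cons_coe,
              Multiset.cons_add] at h2
            have hx : x.natAbs ∈ M := by
              rw [← Finset.mem_val, ← h2]; exact Multiset.mem_cons_self _ _
            obtain ⟨b, hb⟩ := exists_sgn x
            refine ⟨(x.natAbs, b), by simp [hx], ?_⟩
            simp only [H, Finset.mem_image]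
            refine ⟨Function.update f e t, ?_, ?_⟩
            · rw [(hG _ hx).1]
              refine ⟨fun i hi => ?_, ?_⟩
              · have : i ≠ e := by rintro rfl; simp at hi
                rw [Function.update_of_ne this, h1 i hi]
              · rw [sum_update _ _ he, Finset.erase_val, ← h2, Multiset.erase_cons_head]
            · simp [hb, ← hfe]
      · rw [Finset.card_union_of_disjoint, Finset.card_biUnion, Finset.sum_congr rfl Hcard, hc]
        · rw [Finset.sum_const, Finset.card_product, hM, Finset.card_insert_of_notMem he]
          simp only [Finset.card_univ, Fintype.card_bool, smul_eq_mul]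
          have h3 := Nat.succ_ascFactorial E.card m
          rw [Nat.ascFactorial_succ, Nat.ascFactorial_succ, ← h3]
          simp only [Nat.succ_eq_add_one]
          ring
        · intro p hp q hq hpq
          change Disjoint (H p) (H q)
          rw [Finset.disjoint_left]
          intro f hf hf'
          obtain ⟨t, ht⟩ := Hhead p f hf
          obtain ⟨t', ht'⟩ := Hhead q f hf'
          rw [ht, List.cons.injEq] at ht'
          have hp1 : p.1 ≠ 0 := by
            intro h; rw [Finset.mem_coe, Finset.mem_product, h] at hp; exact h0 hp.1
          have := sgn_inj hp1 ht'.1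
          exact hpq (Prod.ext this.1 this.2)
        · rw [Finset.disjoint_left]
          intro f hf hf'
          rw [hF] at hf
          rw [Finset.mem_biUnion] at hf'
          obtain ⟨p, _, hp⟩ := hf'
          obtain ⟨t, ht⟩ := Hhead p f hp
          rw [hf.1 e he] at ht
          simp at ht

/-- multiset of absolute values -/
def amul (l : List ℤ) : Multiset ℕ := ((l.map Int.natAbs : List ℕ) : Multiset ℕ)

lemma mem_sum_amul (P : Finset (List ℤ)) (a : ℕ) :
    a ∈ ∑ l ∈ P, amul l ↔ ∃ l ∈ P, a ∈ l.map Int.natAbs := by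
  simp [Multiset.mem_sum, amul]

lemma nodup_sum (P : Finset (List ℤ)) (h1 : ∀ l ∈ P, (l.map Int.natAbs).Nodup)
    (h2 : ∀ l ∈ P, ∀ l' ∈ P, l ≠ l' →
      Disjoint (l.map Int.natAbs).toFinset (l'.map Int.natAbs).toFinset) :
    (∑ l ∈ P, amul l).Nodup := by
  classical
  induction P using Finset.induction_on with
  | empty => simp
  | insert l P hl ih =>
    rw [Finset.sum_insert hl, Multiset.nodup_add]
    refine ⟨by simpa [amul] using h1 l (by simp), ih (fun l' h => h1 l' (by simp [h]))
      (fun l' h l'' h' => h2 l' (by simp [h]) l'' (by simp [h'])), ?_⟩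
    rw [Multiset.disjoint_left]
    intro a ha ha'
    rw [mem_sum_amul] at ha'
    obtain ⟨l', hl', ha'⟩ := ha'
    have hne : l ≠ l' := by rintro rfl; exact hl hl'
    have := h2 l (by simp) l' (by simp [hl']) hne
    rw [Finset.disjoint_left] at this
    exact this (List.mem_toFinset.2 (by simpa [amul] using ha)) (List.mem_toFinset.2 ha')

lemma of_sum (P : Finset (List ℤ)) (A : Finset ℕ) (h : ∑ l ∈ P, amul l = A.val) :
    (∀ l ∈ P, (l.map Int.natAbs).Nodup) ∧
    (∀ l ∈ P, ∀ l' ∈ P, l ≠ l' →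
      Disjoint (l.map Int.natAbs).toFinset (l'.map Int.natAbs).toFinset) ∧
    P.biUnion (fun l => (l.map Int.natAbs).toFinset) = A := by
  classical
  refine ⟨fun l hl => ?_, fun l hl l' hl' hne => ?_, ?_⟩
  · have : amul l ≤ A.val := by
      rw [← h, ← Finset.add_sum_erase _ _ hl]
      exact Multiset.le_add_right _ _
    simpa [amul] using Multiset.nodup_of_le this A.nodup
  · have : (∑ l ∈ P, amul l).Nodup := h ▸ A.nodup
    rw [← Finset.add_sum_erase _ _ hl, Multiset.nodup_add] at this
    have h3 := this.2.2
    rw [Multiset.disjoint_left] at h3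
    rw [Finset.disjoint_left]
    intro a ha ha'
    refine h3 (a := a) (by simpa [amul] using ha) ?_
    rw [mem_sum_amul]
    exact ⟨l', by simp [hl', Ne.symm hne], List.mem_toFinset.1 ha'⟩
  · ext a
    rw [← Finset.mem_val (s := A), ← h, mem_sum_amul]
    simp

/-- the partition built from ends and prefixes -/
def build (E : Finset ℕ) (f : ℕ → List ℤ) : Finset (List ℤ) :=
  E.image (fun e => f e ++ [(e : ℤ)])

lemma sum_build (E : Finset ℕ) (f : ℕ → List ℤ) :
    ∑ l ∈ build E f, amul l =
      ∑ e ∈ E, (((f e).map Int.natAbs : List ℕ) : Multiset ℕ) + E.val := by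
  rw [build, Finset.sum_image]
  · have : ∀ e ∈ E, amul (f e ++ [(e : ℤ)]) =
        (((f e).map Int.natAbs : List ℕ) : Multiset ℕ) + {e} := by
      intro e _; simp [amul, ← Multiset.coe_add]
    rw [Finset.sum_congr rfl this, Finset.sum_add_distrib, Finset.sum_multiset_singleton]
  · intro e _ e' _ h
    have := List.append_inj_right' h rfl
    simpa using this

lemma build_ends (E : Finset ℕ) (f : ℕ → List ℤ) :
    (build E f).image (fun l => (l.getLastD (-1)).natAbs) = E := by
  ext a
  simp [build]

lemma build_isSPIL (ℓ : ℕ) (E' : Finset ℕ) (hE : E' ⊆ Finset.Icc 1 ℓ) (f : ℕ → List ℤ)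
    (hf : PGood (insert 0 E') (Finset.Icc 1 ℓ \ E') f) :
    IsSPIL0 (Finset.range (ℓ + 1)) (build (insert 0 E') f) := by
  have hsum : ∑ l ∈ build (insert 0 E') f, amul l = (Finset.range (ℓ+1)).val := by
    have h0 : 0 ∉ E' := fun h => by simpa using hE h
    rw [sum_build, hf.2]
    have hd : Disjoint (Finset.Icc 1 ℓ \ E') (insert 0 E') := by
      rw [Finset.disjoint_left]; intro a ha; simp at ha ⊢; exact ⟨by omega, ha.2⟩
    rw [← Finset.disjUnion_val _ _ hd]
    congr 1
    ext a
    have := @hE a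
    simp at this ⊢
    by_cases ha : a ∈ E'
    · have := this ha; simp [ha]; omega
    · simp [ha]; omega
  obtain ⟨h1, h2, h3⟩ := of_sum _ _ hsum
  refine ⟨fun l hl => ⟨?_, ?_, h1 l hl, ?_, ?_⟩, h2, h3⟩
  · simp only [build, Finset.mem_image] at hl
    obtain ⟨e, _, rfl⟩ := hl
    simp
  · intro x hx
    rw [← h3, Finset.mem_biUnion]
    exact ⟨l, hl, by simp; exact ⟨x, hx, rfl⟩⟩
  · simp only [build, Finset.mem_image] at hl
    obtain ⟨e, _, rfl⟩ := hl
    simp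
  · simp only [build, Finset.mem_image] at hl
    obtain ⟨e, he, rfl⟩ := hl
    intro h
    rw [List.mem_append] at h
    rcases h with h | h
    · exfalso
      have : 0 ∈ (Finset.Icc 1 ℓ \ E').val := by
        rw [← hf.2, Multiset.mem_sum]
        exact ⟨e, he, by simpa using h⟩
      rw [Finset.mem_val] at this
      simp at this
    · simp at h; simp [← h]

lemma exists_build (ℓ : ℕ) (P : Finset (List ℤ)) (hP : IsSPIL0 (Finset.range (ℓ + 1)) P) :
    ∃ E', E' ⊆ Finset.Icc 1 ℓ ∧ ∃ f, PGood (insert 0 E') (Finset.Icc 1 ℓ \ E') f ∧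
      build (insert 0 E') f = P := by
  classical
  obtain ⟨h1, h2, h3⟩ := hP
  have hsum : ∑ l ∈ P, amul l = (Finset.range (ℓ+1)).val := by
    refine (Multiset.Nodup.ext (nodup_sum P (fun l hl => (h1 l hl).2.2.1) h2)
      (Finset.nodup _)).2 fun a => ?_
    rw [Finset.mem_val, ← h3, mem_sum_amul]
    simp
  have hform : ∀ l ∈ P, ∃ t, ∃ e : ℕ, l = t ++ [(e : ℤ)] := by
    intro l hl
    obtain ⟨a1, a2, a3, a4, a5⟩ := h1 l hl
    rcases List.eq_nil_or_concat l with h | ⟨t, x, rfl⟩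
    · exact absurd h a1
    · simp at a4
      obtain ⟨n, rfl⟩ := Int.eq_ofNat_of_zero_le a4
      exact ⟨t, n, by simp⟩
  have huniq : ∀ (e : ℕ) t t', t ++ [(e : ℤ)] ∈ P → t' ++ [(e : ℤ)] ∈ P → t = t' := by
    intro e t t' h h'
    by_contra hne
    have := h2 _ h _ h' (fun hh => hne (List.append_cancel_right hh))
    rw [Finset.disjoint_left] at this
    exact this (a := e) (by simp) (by simp)
  let E := P.image (fun l => (l.getLastD (-1)).natAbs)
  let f : ℕ → List ℤ := fun e => if h : ∃ t, t ++ [(e : ℤ)] ∈ P then h.choose else []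
  have hf : ∀ (e : ℕ) t, t ++ [(e : ℤ)] ∈ P → f e = t := by
    intro e t h
    have hex : ∃ t, t ++ [(e : ℤ)] ∈ P := ⟨t, h⟩
    simp only [f, dif_pos hex]
    exact huniq e _ _ hex.choose_spec h
  have hmemE : ∀ e, e ∈ E ↔ ∃ t, t ++ [(e : ℤ)] ∈ P := by
    intro e
    simp only [E, Finset.mem_image]
    constructor
    · rintro ⟨l, hl, h⟩
      obtain ⟨t, n, rfl⟩ := hform l hl
      simp at h
      subst h
      exact ⟨t, hl⟩
    · rintro ⟨t, h⟩
      exact ⟨_, h, by simp⟩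
  have hb : build E f = P := by
    ext l
    simp only [build, Finset.mem_image, hmemE]
    constructor
    · rintro ⟨e, ⟨t, ht⟩, rfl⟩
      rw [hf e t ht]; exact ht
    · intro hl
      obtain ⟨t, n, rfl⟩ := hform l hl
      exact ⟨n, ⟨t, hl⟩, by rw [hf n t hl]⟩
  have h0 : 0 ∈ E := by
    have : 0 ∈ (Finset.range (ℓ+1)) := by simp
    rw [← h3] at this
    simp at this
    obtain ⟨l, hl, hl0⟩ := this
    obtain ⟨a1, a2, a3, a4, a5⟩ := h1 l hl
    simp only [E, Finset.mem_image]
    exact ⟨l, hl, by rw [a5 hl0]; rfl⟩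
  have hs := sum_build E f
  rw [hb, hsum] at hs
  have hEsub : E ⊆ Finset.range (ℓ+1) := by
    rw [← Finset.val_le_iff, hs]; exact Multiset.le_add_left _ _
  have hins : insert 0 (E.erase 0) = E := Finset.insert_erase h0
  refine ⟨E.erase 0, ?_, f, ?_, by rw [hins, hb]⟩
  · intro a ha
    have := hEsub (Finset.mem_of_mem_erase ha)
    have := Finset.ne_of_mem_erase ha
    simp at *; omega
  · rw [hins]
    refine ⟨fun e he => ?_, ?_⟩
    · rw [hmemE] at he
      simp only [f, dif_neg he]
    · have : Finset.Icc 1 ℓ \ E.erase 0 = Finset.range (ℓ+1) \ E := by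
        ext a
        by_cases ha : a = 0
        · subst ha; simp [h0]
        · simp [ha]; omega
      rw [this, Finset.sdiff_val, hs, Multiset.add_sub_cancel_right]

lemma build_inj {E E' M M' : Finset ℕ} {f f' : ℕ → List ℤ} (h : PGood E M f)
    (h' : PGood E' M' f') (hb : build E f = build E' f') : E = E' ∧ f = f' := by
  have hE : E = E' := by rw [← build_ends E f, hb, build_ends]
  subst hE
  refine ⟨rfl, funext fun e => ?_⟩
  by_cases he : e ∈ E
  · have : f e ++ [(e : ℤ)] ∈ build E f' := by
      rw [← hb]; exact Finset.mem_image_of_mem _ he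
    simp only [build, Finset.mem_image] at this
    obtain ⟨e', _, h⟩ := this
    have h4 := List.append_inj' h rfl
    simp at h4
    rw [← h4.1, h4.2]
  · rw [h.1 e he, h'.1 e he]

/-- `|SPIL(ℓ ∪ {0})| = ∑_{k=1}^{ℓ+1} (ℓ!/(k-1)!) · C(ℓ, k-1) · 2^{ℓ-k+1}`. -/
theorem statement9 (ℓ : ℕ) (hl : 1 ≤ ℓ) :
    spil0Count ℓ =
      ∑ k ∈ Finset.Icc 1 (ℓ + 1),
        (ℓ.factorial / (k - 1).factorial) * ℓ.choose (k - 1) * 2 ^ (ℓ + 1 - k) := by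
  classical
  have key : ∀ E' : Finset ℕ, ∃ F : Finset (ℕ → List ℤ),
      (∀ f, f ∈ F ↔ PGood (insert 0 E') (Finset.Icc 1 ℓ \ E') f) ∧
      F.card = 2 ^ (Finset.Icc 1 ℓ \ E').card *
        (insert 0 E').card.ascFactorial (Finset.Icc 1 ℓ \ E').card :=
    fun E' => exists_count _ _ _ rfl (by simp)
  choose F hF hFc using key
  have hset : {P : Finset (List ℤ) | IsSPIL0 (Finset.range (ℓ + 1)) P} =
      (((Finset.Icc 1 ℓ).powerset.sigma F).image
        (fun p => build (insert 0 p.1) p.2) : Finset (Finset (List ℤ))) := by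
    ext P
    simp only [Set.mem_ofPred_eq, Finset.coe_image, Set.mem_image, Finset.mem_coe,
      Finset.mem_sigma, Finset.mem_powerset, hF]
    constructor
    · intro hP
      obtain ⟨E', hE, f, hf, hb⟩ := exists_build ℓ P hP
      exact ⟨⟨E', f⟩, ⟨hE, hf⟩, hb⟩
    · rintro ⟨⟨E', f⟩, ⟨hE, hf⟩, rfl⟩
      exact build_isSPIL ℓ E' hE f hf
  rw [spil0Count, hset, Set.ncard_coe_finset, Finset.card_image_of_injOn, Finset.card_sigma]
  · have hterm : ∀ E' ∈ (Finset.Icc 1 ℓ).powerset, (F E').card =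
        (fun j => 2 ^ (ℓ - j) * (j + 1).ascFactorial (ℓ - j)) E'.card := by
      intro E' hE
      rw [Finset.mem_powerset] at hE
      have h0 : 0 ∉ E' := fun h => by simpa using hE h
      rw [hFc, Finset.card_sdiff_of_subset hE, Finset.card_insert_of_notMem h0]
      simp
    rw [Finset.sum_congr rfl hterm, Finset.sum_powerset_apply_card (fun j => 2 ^ (ℓ - j) * (j + 1).ascFactorial (ℓ - j))]
    simp only [Nat.card_Icc, Nat.add_sub_cancel, smul_eq_mul]
    have hshift := Finset.sum_Ico_add' (fun k => ℓ.choose (k-1) * (2 ^ (ℓ - (k-1)) *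
      ((k-1) + 1).ascFactorial (ℓ - (k-1)))) 0 (ℓ+1) 1
    simp only [Nat.add_sub_cancel] at hshift
    rw [Finset.range_eq_Ico, hshift]
    refine Finset.sum_congr (by ext; simp <;> omega) fun k hk => ?_
    simp at hk
    obtain ⟨j, rfl⟩ : ∃ j, k = j + 1 := ⟨k - 1, by omega⟩
    have hj : j ≤ ℓ := by omega
    have h5 := Nat.factorial_mul_ascFactorial j (ℓ - j)
    rw [Nat.add_sub_cancel' hj] at h5
    have h6 : ℓ.factorial / j.factorial = (j+1).ascFactorial (ℓ - j) :=
      Nat.div_eq_of_eq_mul_right (Nat.factorial_pos j) h5.symm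
    simp only [Nat.add_sub_cancel, Nat.add_sub_add_right, h6]
    ring
  · rintro ⟨E, f⟩ h ⟨E', f'⟩ h' hb
    simp only [Finset.coe_sigma, Set.mem_sigma_iff, Finset.mem_coe, Finset.mem_powerset, hF]
      at h h'
    obtain ⟨hE, rfl⟩ := build_inj h.2 h'.2 hb
    have h0 : 0 ∉ E := fun h9 => by simpa using h.1 h9
    have h0' : 0 ∉ E' := fun h9 => by simpa using h'.1 h9
    have : E = E' := by
      rw [← Finset.erase_insert h0, hE, Finset.erase_insert h0']
    subst this
    rfl

end
end

section
/- Define d : ℕ → ℕ by d(0) = 1 and d(n) = |SPIL(n)| for n ≥ 1. Then for every n ≥ 1, d(n+1) + 4·(n² − n)·d(n−1) = (1 + 4n)·d(n). -/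
open scoped BigOperators

noncomputable section

/-- `d(0) = 1` and `d(n) = |SPIL(n)|` for `n ≥ 1`. -/
def dSPIL : ℕ → ℕ := fun n => if n = 0 then 1 else spilCount n

/-- absolute values -/
def ab (l : List ℤ) : List ℕ := l.map Int.natAbs

def variants (x : ℤ) : List ℤ → Finset (List ℤ)
  | [] => ∅
  | [a] => {[x, a], [-x, a], [a, x], [-a, x]}
  | a :: b :: l => {x :: a :: b :: l, (-x) :: a :: b :: l} ∪
      (variants x (b :: l)).image (List.cons a)

def remv (x : ℤ) : List ℤ → List ℤ
  | [] => []
  | a :: t => if a.natAbs = x.natAbs then t else if t = [x] then [|a|] else a :: remv x t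

lemma variants_perm (x : ℤ) (l : List ℤ) : ∀ l' ∈ variants x l,
    (ab l').Perm (x.natAbs :: ab l) := by
  induction l using variants.induct with
  | case1 => simp [variants]
  | case2 a =>
    simp [variants, ab]
    exact List.Perm.swap _ _ _
  | case3 a b l ih =>
    intro l' h
    simp only [variants, Finset.mem_union, Finset.mem_insert, Finset.mem_singleton,
      Finset.mem_image] at h
    rcases h with (rfl | rfl) | ⟨m, hm, rfl⟩
    · simp [ab]
    · simp [ab]
    · have := ih m hm
      exact (List.Perm.cons a.natAbs this).trans (List.Perm.swap _ _ _)

lemma variants_last (x : ℤ) (hx : 0 < x) (l : List ℤ) (hl : 0 < l.getLastD 0) :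
    ∀ l' ∈ variants x l, 0 < l'.getLastD 0 := by
  induction l using variants.induct with
  | case1 => simp [variants]
  | case2 a =>
    simp at hl
    simp [variants, hl, hx]
  | case3 a b l ih =>
    intro l' h
    simp only [variants, Finset.mem_union, Finset.mem_insert, Finset.mem_singleton,
      Finset.mem_image] at h
    rcases h with (rfl | rfl) | ⟨m, hm, rfl⟩
    · simpa using hl
    · simpa using hl
    · have := ih (by simpa using hl) m hm
      cases m with
      | nil => simp at this
      | cons c m => simpa using this

lemma remv_variants (x : ℤ) (l : List ℤ) (hl : 0 < l.getLastD 0)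
    (hn : x.natAbs ∉ ab l) :
    ∀ l' ∈ variants x l, remv x l' = l := by
  induction l using variants.induct with
  | case1 => simp [variants]
  | case2 a =>
    simp at hl
    simp [ab] at hn
    have : ¬ a.natAbs = x.natAbs := fun h => hn h.symm
    simp [variants, remv, this, abs_of_pos hl]
  | case3 a b l ih =>
    intro l' h
    simp only [variants, Finset.mem_union, Finset.mem_insert, Finset.mem_singleton,
      Finset.mem_image] at h
    have hn2 : x.natAbs ∉ ab (b :: l) := fun h => hn (List.mem_cons_of_mem _ h)
    have hn1 : ¬ a.natAbs = x.natAbs := fun h => hn (by simp [ab, h])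
    rcases h with (rfl | rfl) | ⟨m, hm, rfl⟩
    · simp [remv]
    · simp [remv]
    · have h1 := ih (by simpa using hl) hn2 m hm
      have h2 := (variants_perm x _ m hm).length_eq
      have h3 : m ≠ [x] := by rintro rfl; simp [ab] at h2
      simp [remv, hn1, h3, h1]

lemma variants_card (x : ℤ) (hx : 0 < x) (l : List ℤ) (hl : 0 < l.getLastD 0)
    (hn : x.natAbs ∉ ab l) : (variants x l).card = 2 * (l.length + 1) := by
  induction l using variants.induct with
  | case1 => simp at hl
  | case2 a =>
    simp at hl
    simp [ab] at hn
    have h1 : a ≠ x := by rintro rfl; simp at hn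
    have h2 : a ≠ -x := by rintro rfl; simp at hn
    have h3 : x ≠ -x := by omega
    have h4 : a ≠ -a := by omega
    have h5 : -x ≠ -a := by omega
    have h6 : x ≠ -a := by omega
    have h7 : x ≠ a := by omega
    have h8 : -x ≠ a := by omega
    simp only [variants]
    repeat rw [Finset.card_insert_of_notMem (by simp [*])]
    simp
  | case3 a b l ih =>
    have hn2 : x.natAbs ∉ ab (b :: l) := fun h => hn (List.mem_cons_of_mem _ h)
    have hn1 : ¬ a.natAbs = x.natAbs := fun h => hn (by simp [ab, h])
    have h1 : x ≠ a := by rintro rfl; simp at hn1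
    have h2 : -x ≠ a := by rintro rfl; simp at hn1
    have h3 : x ≠ -x := by omega
    simp only [variants]
    rw [Finset.card_union_of_disjoint, Finset.card_image_of_injective _ List.cons_injective,
      ih (by simpa using hl) hn2, Finset.card_pair (by simp [h3])]
    · simp; ring
    · rw [Finset.disjoint_left]
      simp [h1.symm, h2.symm]

lemma remv_spec (x : ℤ) (hx : 0 < x) (l' : List ℤ) (hl : 0 < l'.getLastD 0)
    (hz : 0 ∉ ab l') (hm : x.natAbs ∈ ab l') (hne : l' ≠ [x]) :
    0 < (remv x l').getLastD 0 ∧ l' ∈ variants x (remv x l') := by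
  induction l' with
  | nil => simp at hl
  | cons a t ih =>
    by_cases ha : a.natAbs = x.natAbs
    · simp only [remv, ha, if_true]
      rcases Int.natAbs_eq_natAbs_iff.1 ha with rfl | rfl
      · rcases t with _ | ⟨b, _ | ⟨c, t⟩⟩
        · simp at hne
        · simpa [variants] using hl
        · simpa [variants] using hl
      · rcases t with _ | ⟨b, _ | ⟨c, t⟩⟩
        · simp at hl; omega
        · simpa [variants] using hl
        · simpa [variants] using hl
    · by_cases ht : t = [x]
      · subst ht
        have h0 : 0 < |a| := by
          rcases eq_or_ne a 0 with rfl | h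
          · simp [ab] at hz
          · exact abs_pos.2 h
        simp only [remv, ha, if_false, if_true]
        refine ⟨by simpa using h0, ?_⟩
        rcases abs_choice a with h | h <;> simp [variants, h]
      · have hmt : x.natAbs ∈ ab t := by
          simp only [ab, List.map_cons, List.mem_cons] at hm
          exact hm.resolve_left (fun h => ha h.symm)
        have htn : t ≠ [] := by rintro rfl; simp [ab] at hmt
        obtain ⟨b, t, rfl⟩ := List.exists_cons_of_ne_nil htn
        obtain ⟨i1, i2⟩ := ih (by simpa using hl) (fun h => hz (List.mem_cons_of_mem _ h)) hmt ht
        have e : remv x (a :: b :: t) = a :: remv x (b :: t) := by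
          rw [remv, if_neg ha, if_neg ht]
        rw [e]
        generalize remv x (b :: t) = r at *
        rcases r with _ | ⟨c, r⟩
        · simp at i1
        · refine ⟨by simpa using i1, ?_⟩
          rw [variants]
          exact Finset.mem_union_right _ (Finset.mem_image_of_mem _ i2)

/-- membership-style reformulation of SPIL -/
structure QS (A : Finset ℕ) (P : Finset (List ℤ)) : Prop where
  z : 0 ∉ A
  nd : ∀ l ∈ P, (ab l).Nodup
  pos : ∀ l ∈ P, 0 < l.getLastD 0
  dis : ∀ l ∈ P, ∀ l' ∈ P, ∀ a, a ∈ ab l → a ∈ ab l' → l = l'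
  mem : ∀ a, a ∈ A ↔ ∃ l ∈ P, a ∈ ab l

lemma isSPIL_iff (A : Finset ℕ) (hA : 0 ∉ A) (P : Finset (List ℤ)) : IsSPIL A P ↔ QS A P := by
  constructor
  · rintro ⟨h1, h2, h3⟩
    refine ⟨hA, fun l hl => (h1 l hl).2.2.1, fun l hl => (h1 l hl).2.2.2, ?_, ?_⟩
    · intro l hl l' hl' a ha ha'
      by_contra hne
      exact Finset.disjoint_left.1 (h2 l hl l' hl' hne) (List.mem_toFinset.2 ha)
        (List.mem_toFinset.2 ha')
    · intro a
      rw [← h3]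
      simp only [Finset.mem_biUnion, List.mem_toFinset, ab]
  · rintro ⟨-, h1, h2, h3, h4⟩
    refine ⟨fun l hl => ⟨?_, ?_, h1 l hl, h2 l hl⟩, ?_, ?_⟩
    · rintro rfl
      simpa using h2 _ hl
    · intro y hy
      have : y.natAbs ∈ A := (h4 _).2 ⟨l, hl, List.mem_map_of_mem hy⟩
      refine ⟨?_, this⟩
      rintro rfl
      exact hA this
    · intro l hl l' hl' hne
      rw [Finset.disjoint_left]
      intro a ha ha'
      exact hne (h3 l hl l' hl' a (List.mem_toFinset.1 ha) (List.mem_toFinset.1 ha'))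
    · ext a
      rw [h4]
      simp only [Finset.mem_biUnion, List.mem_toFinset, ab]

lemma exists_mem_ab {l : List ℤ} (h : 0 < l.getLastD 0) : ∃ a, a ∈ ab l := by
  cases l with
  | nil => simp at h
  | cons a l => exact ⟨a.natAbs, by simp [ab]⟩

lemma QS.insert_single {A : Finset ℕ} {P : Finset (List ℤ)} (h : QS A P) {x : ℤ} (hx : 0 < x)
    (hA : x.natAbs ∉ A) : QS (insert x.natAbs A) (insert [x] P) := by
  obtain ⟨h0, h1, h2, h3, h4⟩ := h
  have e : ∀ a, a ∈ ab [x] ↔ a = x.natAbs := by simp [ab]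
  have e2 : (ab [x]).Nodup := by simp [ab]
  have e3 : 0 < [x].getLastD 0 := by simpa using hx
  have e4 : x.natAbs ≠ 0 := by omega
  generalize [x] = s at *
  generalize x.natAbs = X at *
  constructor <;> grind

lemma QS.insert_var {A : Finset ℕ} {P : Finset (List ℤ)} (h : QS A P) {x : ℤ} (hx : 0 < x)
    (hA : x.natAbs ∉ A) {l l' : List ℤ} (hl : l ∈ P) (hl' : l' ∈ variants x l) :
    QS (insert x.natAbs A) (insert l' (P.erase l)) := by
  obtain ⟨h0, h1, h2, h3, h4⟩ := h
  have p := variants_perm x l l' hl'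
  have e : ∀ a, a ∈ ab l' ↔ a = x.natAbs ∨ a ∈ ab l := by
    intro a; rw [p.mem_iff]; simp
  have e2 : (ab l').Nodup := by
    rw [p.nodup_iff, List.nodup_cons]
    exact ⟨fun hh => hA ((h4 _).2 ⟨l, hl, hh⟩), h1 l hl⟩
  have e3 : 0 < l'.getLastD 0 := variants_last x hx l (h2 l hl) l' hl'
  have e4 : x.natAbs ≠ 0 := by omega
  clear hl' p
  generalize x.natAbs = X at *
  constructor
  · grind
  · grind
  · grind
  · grind
  · intro a
    simp only [Finset.mem_insert, Finset.mem_erase, h4]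
    constructor
    · rintro (rfl | ⟨m, hm, ha⟩)
      · exact ⟨l', by simp, by grind⟩
      · by_cases hml : m = l
        · exact ⟨l', by simp, by grind⟩
        · exact ⟨m, by grind, ha⟩
    · grind

lemma QS.cases {A : Finset ℕ} {P' : Finset (List ℤ)} {x : ℤ} (hx : 0 < x)
    (hA : x.natAbs ∉ A) (h : QS (insert x.natAbs A) P') :
    (∃ P, QS A P ∧ insert [x] P = P') ∨
    ∃ P, QS A P ∧ ∃ l ∈ P, ∃ l' ∈ variants x l, insert l' (P.erase l) = P' := by
  obtain ⟨h0, h1, h2, h3, h4⟩ := h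
  obtain ⟨l', hl', hxl'⟩ := (h4 x.natAbs).1 (by simp)
  by_cases hs : l' = [x]
  · left
    refine ⟨P'.erase [x], ?_, Finset.insert_erase (hs ▸ hl')⟩
    have e : ∀ a, a ∈ ab l' ↔ a = x.natAbs := by simp [ab, hs]
    rw [← hs]
    clear hs
    generalize x.natAbs = X at *
    constructor
    · grind
    · grind
    · grind
    · grind
    · intro a
      constructor
      · intro ha
        obtain ⟨m, hm, ham⟩ := (h4 a).1 (by simp [ha])
        exact ⟨m, by grind, ham⟩
      · rintro ⟨m, hm, ham⟩
        have := (h4 a).2 ⟨m, by grind, ham⟩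
        grind
  · right
    have hz : 0 ∉ ab l' := fun hh => h0 ((h4 0).2 ⟨l', hl', hh⟩)
    obtain ⟨i1, i2⟩ := remv_spec x hx l' (h2 _ hl') hz hxl' hs
    generalize remv x l' = l at *
    have p := variants_perm x l l' i2
    have e : ∀ a, a ∈ ab l' ↔ a = x.natAbs ∨ a ∈ ab l := by
      intro a; rw [p.mem_iff]; simp
    have e2 : x.natAbs ∉ ab l ∧ (ab l).Nodup := by
      rw [← List.nodup_cons, ← p.nodup_iff]; exact h1 _ hl'
    have hl : l ∉ P'.erase l' := by
      intro hh
      obtain ⟨a, ha⟩ := exists_mem_ab i1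
      have := h3 l (Finset.mem_of_mem_erase hh) l' hl' a ha ((e a).2 (Or.inr ha))
      exact (Finset.ne_of_mem_erase hh) this
    refine ⟨insert l (P'.erase l'), ?_, l, by simp, l', i2, ?_⟩
    · clear i2 p
      generalize x.natAbs = X at *
      constructor
      · grind
      · grind
      · grind
      · grind
      · intro a
        constructor
        · intro ha
          obtain ⟨m, hm, ham⟩ := (h4 a).1 (by simp [ha])
          by_cases hml : m = l'
          · exact ⟨l, by simp, by grind⟩
          · exact ⟨m, by grind, ham⟩
        · rintro ⟨m, hm, ham⟩
          have : a ∈ insert X A := (h4 a).2 (by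
            rcases Finset.mem_insert.1 hm with rfl | hm
            · exact ⟨l', hl', (e a).2 (Or.inr ham)⟩
            · exact ⟨m, by grind, ham⟩)
          grind
    · rw [Finset.erase_insert hl, Finset.insert_erase hl']

def SS : ℕ → Finset (Finset (List ℤ))
  | 0 => {∅}
  | n + 1 => (SS n).image (insert [((n + 1 : ℕ) : ℤ)]) ∪
      ((SS n).sigma (fun P => P.sigma (fun l => variants ((n + 1 : ℕ) : ℤ) l))).image
        (fun t => insert t.2.2 (t.1.erase t.2.1))

lemma mem_SS (n : ℕ) : ∀ P, P ∈ SS n ↔ QS (Finset.Icc 1 n) P := by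
  induction n with
  | zero =>
    intro P
    simp only [SS, Finset.mem_singleton]
    constructor
    · rintro rfl
      constructor <;> simp
    · intro h
      rw [Finset.eq_empty_iff_forall_notMem]
      intro l hl
      obtain ⟨a, ha⟩ := exists_mem_ab (h.pos l hl)
      simpa using (h.mem a).2 ⟨l, hl, ha⟩
  | succ n ih =>
    intro P
    have e : Finset.Icc 1 (n + 1) = insert (((n + 1 : ℕ) : ℤ).natAbs) (Finset.Icc 1 n) := by
      ext a; simp only [Finset.mem_Icc, Finset.mem_insert]; omega
    have hx : (0 : ℤ) < ((n + 1 : ℕ) : ℤ) := by omega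
    have hA : ((n + 1 : ℕ) : ℤ).natAbs ∉ Finset.Icc 1 n := by
      simp only [Finset.mem_Icc]; omega
    rw [e, SS]
    generalize ((n + 1 : ℕ) : ℤ) = x at *
    simp only [Finset.mem_union, Finset.mem_image, Finset.mem_sigma, ih, Sigma.exists]
    constructor
    · rintro (⟨P, hP, rfl⟩ | ⟨P, l, l', ⟨hP, hl, hl'⟩, rfl⟩)
      · exact hP.insert_single hx hA
      · exact hP.insert_var hx hA hl hl'
    · intro h
      rcases QS.cases hx hA h with ⟨P, hP, rfl⟩ | ⟨P, hP, l, hl, l', hl', rfl⟩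
      · exact Or.inl ⟨P, hP, rfl⟩
      · exact Or.inr ⟨P, l, l', ⟨hP, hl, hl'⟩, rfl⟩

lemma dSPIL_eq (n : ℕ) : dSPIL n = (SS n).card := by
  rcases Nat.eq_zero_or_pos n with rfl | hn
  · simp [dSPIL, SS]
  · rw [dSPIL, if_neg hn.ne', spilCount, ← Set.ncard_coe_finset]
    congr 1
    ext P
    simp only [Set.mem_ofPred_eq, Finset.mem_coe, mem_SS]
    exact isSPIL_iff _ (by simp) P

lemma QS.sum_length {A : Finset ℕ} {P : Finset (List ℤ)} (h : QS A P) :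
    ∑ l ∈ P, l.length = A.card := by
  have : A = P.biUnion (fun l => (ab l).toFinset) := by
    ext a; rw [h.mem]; simp
  rw [this, Finset.card_biUnion]
  · refine Finset.sum_congr rfl fun l hl => ?_
    rw [List.toFinset_card_of_nodup (h.nd l hl)]; simp [ab]
  · intro l hl l' hl' hne
    refine Finset.disjoint_left.2 ?_
    intro a ha ha'
    exact hne (h.dis l hl l' hl' a (List.mem_toFinset.1 ha) (List.mem_toFinset.1 ha'))

lemma SS_sum (n : ℕ) (f : ℕ → ℤ) : ∑ P ∈ SS (n + 1), f P.card =
    ∑ P ∈ SS n, (f (P.card + 1) + 2 * ((n : ℤ) + P.card) * f P.card) := by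
  have hx : (0 : ℤ) < ((n + 1 : ℕ) : ℤ) := by omega
  have hA : ((n + 1 : ℕ) : ℤ).natAbs ∉ Finset.Icc 1 n := by
    simp only [Finset.mem_Icc]; omega
  have key : ∀ P ∈ SS n, ∀ l ∈ P, ((n + 1 : ℕ) : ℤ).natAbs ∉ ab l := by
    intro P hP l hl hh
    exact hA ((((mem_SS n P).1 hP).mem _).2 ⟨l, hl, hh⟩)
  rw [SS]
  generalize ((n + 1 : ℕ) : ℤ) = x at *
  have key1 : ∀ P ∈ SS n, [x] ∉ P := fun P hP hh => key P hP _ hh (by simp [ab])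
  have key2 : ∀ P ∈ SS n, ∀ l ∈ P, ∀ l' ∈ variants x l, x.natAbs ∈ ab l' := by
    intro P hP l hl l' hl'
    rw [(variants_perm x l l' hl').mem_iff]; simp
  have key3 : ∀ P ∈ SS n, ∀ l ∈ P, ∀ l' ∈ variants x l, l' ∉ P.erase l := by
    intro P hP l hl l' hl' hh
    exact key P hP l' (Finset.mem_of_mem_erase hh) (key2 P hP l hl l' hl')
  rw [Finset.sum_union, Finset.sum_image, Finset.sum_image, Finset.sum_sigma,
    Finset.sum_add_distrib]
  · congr 1
    · refine Finset.sum_congr rfl fun P hP => ?_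
      rw [Finset.card_insert_of_notMem (key1 P hP)]
    · refine Finset.sum_congr rfl fun P hP => ?_
      have hQ := (mem_SS n P).1 hP
      rw [Finset.sum_sigma]
      have : ∀ l ∈ P, ∑ l' ∈ variants x l, f (insert l' (P.erase l)).card
          = (2 * ((l.length : ℤ) + 1)) * f P.card := by
        intro l hl
        rw [Finset.sum_congr rfl (g := fun _ => f P.card)]
        · rw [Finset.sum_const, variants_card x hx l (hQ.pos l hl) (key P hP l hl)]
          simp
        · intro l' hl'
          rw [Finset.card_insert_of_notMem (key3 P hP l hl l' hl'),
            Finset.card_erase_add_one hl]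
      rw [Finset.sum_congr rfl this, ← Finset.sum_mul, ← Finset.mul_sum, Finset.sum_add_distrib]
      have h2 := hQ.sum_length
      simp only [Nat.card_Icc, Nat.add_sub_cancel] at h2
      rw [← Nat.cast_sum, h2]
      simp
  · rintro ⟨P, l, l'⟩ h1 ⟨R, m, m'⟩ h2 he
    simp only [Finset.coe_sigma, Set.mem_sigma_iff, Finset.mem_coe] at h1 h2 he
    obtain ⟨hP, hl, hl'⟩ := h1
    obtain ⟨hR, hm, hm'⟩ := h2
    have e1 : l' = m' := by
      have : l' ∈ insert m' (R.erase m) := he ▸ Finset.mem_insert_self _ _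
      rcases Finset.mem_insert.1 this with h | h
      · exact h
      · exact absurd (key2 P hP l hl l' hl') (key R hR l' (Finset.mem_of_mem_erase h))
    subst e1
    have e2 : l = m := by
      rw [← remv_variants x l (((mem_SS n P).1 hP).pos l hl) (key P hP l hl) l' hl',
        ← remv_variants x m (((mem_SS n R).1 hR).pos m hm) (key R hR m hm) l' hm']
    subst e2
    have e3 : P = R := by
      rw [← Finset.insert_erase hl, ← Finset.insert_erase hm,
        ← Finset.erase_insert (key3 P hP l hl l' hl'), he,
        Finset.erase_insert (key3 R hR l hm l' hm')]
    subst e3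
    rfl
  · intro P hP R hR he
    rw [← Finset.erase_insert (key1 P hP), he, Finset.erase_insert (key1 R hR)]
  · rw [Finset.disjoint_left]
    intro P' h1 h2
    simp only [Finset.mem_image, Finset.mem_sigma, Sigma.exists] at h1 h2
    obtain ⟨P, hP, rfl⟩ := h1
    obtain ⟨R, l, l', ⟨hR, hl, hl'⟩, he⟩ := h2
    have h3 : [x] ∈ insert l' (R.erase l) := he ▸ Finset.mem_insert_self _ _
    rcases Finset.mem_insert.1 h3 with h | h
    · have h5 := (variants_perm x l l' hl').length_eq
      have := ((mem_SS n R).1 hR).pos l hl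
      rw [← h] at h5
      cases l with
      | nil => simp at this
      | cons a l => simp [ab] at h5
    · exact key1 R hR (Finset.mem_of_mem_erase h)

/-- number of SPILs with k lists -/
def sk (n k : ℕ) : ℤ := ∑ P ∈ SS n, if P.card = k then 1 else 0

lemma sk_succ_zero (n : ℕ) : sk (n + 1) 0 = 2 * n * sk n 0 := by
  rw [sk, SS_sum n (fun c => if c = 0 then 1 else 0), sk, Finset.mul_sum]
  refine Finset.sum_congr rfl fun P _ => ?_
  by_cases h : P.card = 0
  · simp [h]
  · simp [h]

lemma sk_succ_succ (n k : ℕ) :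
    sk (n + 1) (k + 1) = sk n k + 2 * (n + k + 1) * sk n (k + 1) := by
  rw [sk, SS_sum n (fun c => if c = k + 1 then 1 else 0), sk, sk, Finset.mul_sum,
    ← Finset.sum_add_distrib]
  refine Finset.sum_congr rfl fun P _ => ?_
  by_cases h : P.card = k + 1
  · simp [h]; ring
  · simp [h]

lemma sk_rel (n : ℕ) : ∀ k, ((n : ℤ) + 1 - k) * sk (n + 1) k = 2 * (n + 1) * n * sk n k := by
  induction n with
  | zero =>
    intro k
    cases k with
    | zero => simp [sk_succ_zero]
    | succ k =>
      rw [sk_succ_succ]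
      cases k <;> simp [sk, SS, Finset.sum_singleton, -Finset.sum_boole]
  | succ n ih =>
    intro k
    cases k with
    | zero =>
      have := ih 0
      rw [sk_succ_zero]
      push_cast at *
      ring
    | succ k =>
      have h1 := ih k
      have h2 := ih (k + 1)
      have h3 := sk_succ_succ n k
      rw [sk_succ_succ]
      push_cast at *
      linear_combination h1 - 2 * (n + 1 : ℤ) * n * h3 + 2 * (n + k + 2 : ℤ) * h2 - 2 * h2

lemma sum_sk (n m : ℕ) (g : ℕ → ℤ) (h : ∀ P ∈ SS n, P.card < m) :
    ∑ k ∈ Finset.range m, g k * sk n k = ∑ P ∈ SS n, g P.card := by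
  simp only [sk, Finset.mul_sum]
  rw [Finset.sum_comm]
  refine Finset.sum_congr rfl fun P hP => ?_
  simp [h P hP]

/-- For `n ≥ 1`, `d(n+1) + 4(n² - n) d(n-1) = (1 + 4n) d(n)`. -/
theorem statement11 (n : ℕ) (hn : 1 ≤ n) :
    dSPIL (n + 1) + 4 * (n ^ 2 - n) * dSPIL (n - 1) = (1 + 4 * n) * dSPIL n := by
  obtain ⟨n, rfl⟩ : ∃ m, n = m + 1 := ⟨n - 1, by omega⟩
  have e : (n + 1) ^ 2 - (n + 1) = (n + 1) * n := by
    rw [Nat.sub_eq_iff_eq_add (by nlinarith)]; ring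
  rw [e, Nat.add_sub_cancel, dSPIL_eq, dSPIL_eq, dSPIL_eq]
  obtain ⟨m, hm⟩ : ∃ m, ∀ P ∈ SS n ∪ SS (n + 1), P.card < m :=
    ⟨(SS n ∪ SS (n + 1)).sup Finset.card + 1,
      fun P hP => Nat.lt_succ_of_le (Finset.le_sup (f := Finset.card) hP)⟩
  have a1 := sum_sk n m (fun _ => 2 * (n + 1) * n) (fun P hP => hm P (by simp [hP]))
  have a2 := sum_sk (n + 1) m (fun k => (n : ℤ) + 1 - k) (fun P hP => hm P (by simp [hP]))
  have a3 := SS_sum (n + 1) (fun _ => 1)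
  simp only [sk_rel] at a2
  rw [a1] at a2
  simp only [Finset.sum_const, Finset.sum_sub_distrib, Finset.sum_add_distrib, mul_one,
    ← Finset.mul_sum, nsmul_eq_mul] at a2 a3
  zify
  push_cast at *
  linear_combination a3 + 2 * a2

end
end

section
/- For every n ≥ 1, |SPIL(n)| = ∑_{k=1}^{n} L(n,k)·|PIL(k)|; that is, the sequence counting signed partitions into lists of {1,…,n} is the Lah transform of the sequence counting partitions of {1,…,n} into lists. -/
open scoped BigOperators

noncomputable section

/-- `P` is a partition of the finite set `A` into (nonempty, duplicate-free) lists: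
every element of `A` appears exactly once in exactly one of the lists of `P`. -/
def IsPIL (A : Finset ℕ) (P : Finset (List ℕ)) : Prop :=
  (∀ l ∈ P, l.Nodup ∧ l ≠ []) ∧
  (∀ l ∈ P, ∀ l' ∈ P, l ≠ l' → Disjoint l.toFinset l'.toFinset) ∧
  P.biUnion (fun l => l.toFinset) = A

/-- `|PIL(n)|`: the number of partitions of `{1, …, n}` into lists. -/
def pilCount (n : ℕ) : ℕ := Set.ncard {P : Finset (List ℕ) | IsPIL (Finset.Icc 1 n) P}

/-- Rational Lah numbers. -/
def lahQ : ℕ → ℕ → ℚ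
  | 0, 0 => 1
  | 0, _ + 1 => 0
  | _ + 1, 0 => 0
  | n + 1, k + 1 => ((n + 1).factorial : ℚ) / ((k + 1).factorial : ℚ) * (n.choose k : ℚ)

/-- Weighted total Lah numbers. -/
def lahTot (q : ℚ) (n : ℕ) : ℚ := ∑ k ∈ Finset.range (n + 1), q ^ (n - k) * lahQ n k

theorem lahQ_eq_zero {n k : ℕ} (h : n < k) : lahQ n k = 0 := by
  match n, k with
  | 0, 0 => omega
  | 0, _ + 1 => rfl
  | _ + 1, 0 => rfl
  | n + 1, k + 1 =>
    have : n.choose k = 0 := Nat.choose_eq_zero_of_lt (by omega)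
    simp [lahQ, this]

theorem hockey1 (k m : ℕ) : ∑ i ∈ Finset.range m, i.choose k = m.choose (k + 1) := by
  induction m with
  | zero => simp
  | succ m ih => rw [Finset.sum_range_succ, ih, Nat.choose_succ_succ]; ring

theorem hockey2 (k m : ℕ) :
    ∑ i ∈ Finset.range m, ((m : ℚ) - i) * (i.choose k : ℚ) = ((m + 1).choose (k + 2) : ℚ) := by
  induction m with
  | zero => simp [Nat.choose_eq_zero_of_lt (show 0 + 1 < k + 2 by omega)]
  | succ m ih =>
    have h1 : ∑ i ∈ Finset.range (m + 1), (i.choose k : ℚ) = ((m + 1).choose (k + 1) : ℚ) := by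
      exact_mod_cast hockey1 k (m + 1)
    have h2 : ∑ i ∈ Finset.range (m + 1), ((m : ℚ) - i) * (i.choose k : ℚ)
        = ((m + 1).choose (k + 2) : ℚ) := by
      rw [Finset.sum_range_succ, ih]; simp
    have h3 : ((m + 1 + 1).choose (k + 2) : ℚ)
        = ((m + 1).choose (k + 1) : ℚ) + ((m + 1).choose (k + 2) : ℚ) := by
      exact_mod_cast Nat.choose_succ_succ (m + 1) (k + 1)
    rw [h3, ← h1, ← h2, ← Finset.sum_add_distrib]
    refine Finset.sum_congr rfl fun i _ => ?_
    push_cast; ring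

theorem lahQ_conv (m k : ℕ) :
    lahQ (m + 1) (k + 1) =
      ∑ j ∈ Finset.range (m + 1), (m.choose j : ℚ) * ((j + 1).factorial : ℚ) * lahQ (m - j) k := by
  rw [Finset.sum_range_succ]
  match k with
  | 0 =>
    rw [Finset.sum_eq_zero]
    · simp [lahQ]
    · intro j hj
      rw [Finset.mem_range] at hj
      obtain ⟨d, hd⟩ : ∃ d, m - j = d + 1 := ⟨m - j - 1, by omega⟩
      simp [hd, lahQ]
  | k + 1 =>
    rw [Nat.sub_self]
    have h0 : lahQ 0 (k + 1) = 0 := rfl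
    rw [h0, mul_zero, add_zero, ← Finset.sum_range_reflect]
    have h1 : ∀ i ∈ Finset.range m,
        (m.choose (m - 1 - i) : ℚ) * ((m - 1 - i + 1).factorial : ℚ) * lahQ (m - (m - 1 - i)) (k + 1)
        = (m.factorial : ℚ) / ((k + 1).factorial : ℚ) * (((m : ℚ) - i) * (i.choose k : ℚ)) := by
      intro i hi
      rw [Finset.mem_range] at hi
      obtain ⟨d, rfl⟩ : ∃ d, m = d + i + 1 := ⟨m - 1 - i, by omega⟩
      have e1 : d + i + 1 - 1 - i = d := by omega
      have e2 : d + i + 1 - d = i + 1 := by omega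
      rw [e1, e2]
      have h := Nat.choose_mul_factorial_mul_factorial (show d ≤ d + i + 1 by omega)
      rw [e2] at h
      have hq : ((d + i + 1).choose d : ℚ) * (d.factorial : ℚ) * ((i + 1).factorial : ℚ)
        = ((d + i + 1).factorial : ℚ) := by exact_mod_cast h
      rw [← hq]
      simp only [lahQ]
      rw [Nat.factorial_succ d]
      push_cast
      ring
    rw [Finset.sum_congr rfl h1, ← Finset.mul_sum, hockey2]
    simp only [lahQ]
    have h := Nat.add_one_mul_choose_eq m (k + 1)
    have hq : ((m : ℚ) + 1) * (m.choose (k + 1) : ℚ) = ((m + 1).choose (k + 2) : ℚ) * ((k : ℚ) + 2) := by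
      have : (((m + 1) * m.choose (k + 1) : ℕ) : ℚ) = (((m + 1).choose (k + 1 + 1) * (k + 1 + 1) : ℕ) : ℚ) := by
        rw [h]
      push_cast at this
      rw [this]; ring
    rw [Nat.factorial_succ m, Nat.factorial_succ (k + 1)]
    have hk : ((k + 1).factorial : ℚ) ≠ 0 := by positivity
    have hk2 : ((k : ℚ) + 2) ≠ 0 := by positivity
    have hk3 : ((k : ℚ) + 1 + 1) ≠ 0 := by positivity
    push_cast
    field_simp
    linear_combination hq

theorem lahTot_zero (q : ℚ) : lahTot q 0 = 1 := by
  simp [lahTot, lahQ]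

theorem lahTot_succ (q : ℚ) (m : ℕ) :
    lahTot q (m + 1) = ∑ j ∈ Finset.range (m + 1),
      (m.choose j : ℚ) * (((j + 1).factorial : ℚ) * q ^ j * lahTot q (m - j)) := by
  have hT : ∀ n, n ≤ m → lahTot q n = ∑ k ∈ Finset.range (m + 1), q ^ (n - k) * lahQ n k := by
    intro n hn
    unfold lahTot
    apply Finset.sum_subset
    · intro x; simp; omega
    · intro x _ hx
      rw [lahQ_eq_zero, mul_zero]
      simpa using hx
  have h1 : lahTot q (m + 1) = ∑ k ∈ Finset.range (m + 1), q ^ (m - k) * lahQ (m + 1) (k + 1) := by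
    unfold lahTot
    rw [Finset.sum_range_succ']
    simp [lahQ]
  rw [h1]
  simp_rw [lahQ_conv, Finset.mul_sum]
  rw [Finset.sum_comm]
  refine Finset.sum_congr rfl fun j hj => ?_
  rw [hT (m - j) (by omega), Finset.mul_sum, Finset.mul_sum]
  refine Finset.sum_congr rfl fun k hk => ?_
  rw [Finset.mem_range] at hj hk
  by_cases h : m - j < k
  · rw [lahQ_eq_zero h]; simp
  · have : m - k = j + (m - j - k) := by omega
    rw [this, pow_add]; ring

theorem sum_choose_choose (m j : ℕ) (hj : j ≤ m) :
    ∑ k ∈ Finset.range (m + 1), m.choose k * k.choose j = 2 ^ (m - j) * m.choose j := by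
  obtain ⟨d, rfl⟩ := Nat.exists_eq_add_of_le hj
  rw [show j + d + 1 = j + (d + 1) by ring, Finset.sum_range_add, Finset.sum_eq_zero, zero_add,
    Nat.add_sub_cancel_left, ← Nat.sum_range_choose, Finset.sum_mul]
  · refine Finset.sum_congr rfl fun i hi => ?_
    rw [Finset.mem_range] at hi
    rw [Nat.choose_mul (by omega)]
    simp [mul_comm]
  · intro k hk
    rw [Finset.mem_range] at hk
    rw [Nat.choose_eq_zero_of_lt hk, mul_zero]

theorem lahTot_transform (m : ℕ) :
    lahTot 2 (m + 1) = ∑ k ∈ Finset.range (m + 1), lahQ (m + 1) (k + 1) * lahTot 1 (k + 1) := by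
  have h1 : ∀ k ∈ Finset.range (m + 1), lahTot 1 (k + 1)
      = ∑ j ∈ Finset.range (m + 1), lahQ (k + 1) (j + 1) := by
    intro k hk
    unfold lahTot
    rw [Finset.sum_range_succ']
    simp only [one_pow, one_mul, lahQ, add_zero]
    apply Finset.sum_subset
    · intro x; simp at hk ⊢; omega
    · intro x _ hx
      rw [Nat.choose_eq_zero_of_lt]
      · simp
      · simpa using hx
  have h2 : lahTot 2 (m + 1) = ∑ k ∈ Finset.range (m + 1), 2 ^ (m - k) * lahQ (m + 1) (k + 1) := by
    unfold lahTot
    rw [Finset.sum_range_succ']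
    simp [lahQ]
  rw [h2, Finset.sum_congr (g := fun k => lahQ (m + 1) (k + 1) *
    ∑ j ∈ Finset.range (m + 1), lahQ (k + 1) (j + 1)) (s₁ := Finset.range (m + 1))
    (f := fun k => lahQ (m + 1) (k + 1) * lahTot 1 (k + 1)) rfl fun k hk => by rw [h1 k hk]]
  simp_rw [Finset.mul_sum]
  rw [Finset.sum_comm]
  refine Finset.sum_congr rfl fun j hj => ?_
  rw [Finset.mem_range] at hj
  have h3 := sum_choose_choose m j (by omega)
  have h3q : ∑ k ∈ Finset.range (m + 1), (m.choose k : ℚ) * (k.choose j : ℚ)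
      = 2 ^ (m - j) * (m.choose j : ℚ) := by exact_mod_cast h3
  simp only [lahQ]
  rw [show (2 : ℚ) ^ (m - j) * (((m + 1).factorial : ℚ) / ((j + 1).factorial : ℚ) * (m.choose j : ℚ))
    = ((m + 1).factorial : ℚ) / ((j + 1).factorial : ℚ) * (2 ^ (m - j) * (m.choose j : ℚ)) by ring,
    ← h3q, Finset.mul_sum]
  refine Finset.sum_congr rfl fun k _ => ?_
  have : ((k + 1).factorial : ℚ) ≠ 0 := by positivity
  field_simp

/-- Generic partition into blocks of type `β` with supports. -/
def IsPart {β : Type} [DecidableEq β] (V : β → Prop) (supp : β → Finset ℕ) (A : Finset ℕ)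
    (P : Finset β) : Prop :=
  (∀ l ∈ P, V l) ∧ (∀ l ∈ P, ∀ l' ∈ P, l ≠ l' → Disjoint (supp l) (supp l')) ∧
  P.biUnion supp = A

theorem isPart_count {β : Type} [DecidableEq β] (V : β → Prop) (supp : β → Finset ℕ)
    (hV : ∀ l, V l → (supp l).Nonempty) (q : ℚ)
    (hL : ∀ B : Finset ℕ, B.Nonempty → 0 ∉ B → ∃ F : Finset β, (∀ l, l ∈ F ↔ V l ∧ supp l = B) ∧
      (F.card : ℚ) = (B.card.factorial : ℚ) * q ^ (B.card - 1)) (n : ℕ) :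
    ∀ A : Finset ℕ, A.card = n → 0 ∉ A → ∃ F : Finset (Finset β), (∀ P, P ∈ F ↔ IsPart V supp A P) ∧
      (F.card : ℚ) = lahTot q n := by
  induction n using Nat.strong_induction_on with
  | _ n ih =>
  intro A hA h0
  match n with
  | 0 =>
    rw [Finset.card_eq_zero] at hA
    subst hA
    refine ⟨{∅}, fun P => ?_, by simp [lahTot_zero]⟩
    rw [Finset.mem_singleton]
    constructor
    · rintro rfl; simp [IsPart]
    · rintro ⟨h1, _, h3⟩
      by_contra hne
      obtain ⟨l, hl⟩ := Finset.nonempty_iff_ne_empty.mpr hne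
      obtain ⟨x, hx⟩ := hV l (h1 l hl)
      have : x ∈ P.biUnion supp := Finset.mem_biUnion.mpr ⟨l, hl, hx⟩
      simp [h3] at this
  | m + 1 =>
    obtain ⟨a, A', ha, rfl, hA'⟩ := Finset.card_eq_succ.mp hA
    have h0' : 0 ∉ A' := fun h => h0 (Finset.mem_insert_of_mem h)
    have h0a : (0 : ℕ) ≠ a := fun h => h0 (h ▸ Finset.mem_insert_self _ _)
    have key1 : ∀ B : Finset ℕ, ∃ F : Finset β, B ⊆ A' → (∀ l, l ∈ F ↔ V l ∧ supp l = insert a B) ∧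
        (F.card : ℚ) = ((B.card + 1).factorial : ℚ) * q ^ B.card := by
      intro B
      by_cases hB : B ⊆ A'
      · obtain ⟨F, hF1, hF2⟩ := hL (insert a B) (Finset.insert_nonempty _ _) (by
          rw [Finset.mem_insert]; rintro (h | h)
          · exact h0a h
          · exact h0' (hB h))
        rw [Finset.card_insert_of_notMem (fun h => ha (hB h))] at hF2
        exact ⟨F, fun _ => ⟨hF1, by simpa using hF2⟩⟩
      · exact ⟨∅, fun h => absurd h hB⟩
    have key2 : ∀ B : Finset ℕ, ∃ F : Finset (Finset β), B ⊆ A' →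
        (∀ P, P ∈ F ↔ IsPart V supp (A' \ B) P) ∧ (F.card : ℚ) = lahTot q (m - B.card) := by
      intro B
      by_cases hB : B ⊆ A'
      · obtain ⟨F, hF⟩ := ih (m - B.card) (by omega) (A' \ B)
          (by rw [Finset.card_sdiff_of_subset hB, hA'])
          (fun h => h0' (Finset.mem_sdiff.mp h).1)
        exact ⟨F, fun _ => hF⟩
      · exact ⟨∅, fun h => absurd h hB⟩
    choose LF hLF using key1
    choose PF hPF using key2
    refine ⟨(A'.powerset.sigma (fun B => LF B ×ˢ PF B)).image (fun x => insert x.2.1 x.2.2),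
      fun P => ?_, ?_⟩
    · simp only [Finset.mem_image, Finset.mem_sigma, Finset.mem_powerset, Finset.mem_product]
      constructor
      · rintro ⟨⟨B, l, Q⟩, ⟨hB, hl, hQ⟩, rfl⟩
        simp only at hB hl hQ ⊢
        obtain ⟨hl1, hl2⟩ := ((hLF B hB).1 l).1 hl
        obtain ⟨hQ1, hQ2, hQ3⟩ := ((hPF B hB).1 Q).1 hQ
        have hd : ∀ l' ∈ Q, Disjoint (supp l) (supp l') := by
          intro l' hl'
          rw [hl2, Finset.disjoint_right]
          intro x hx hx'
          have : x ∈ A' \ B := hQ3 ▸ Finset.mem_biUnion.mpr ⟨l', hl', hx⟩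
          rw [Finset.mem_sdiff] at this
          rcases Finset.mem_insert.mp hx' with rfl | h
          · exact ha this.1
          · exact this.2 h
        refine ⟨?_, ?_, ?_⟩
        · intro l' hl'
          rcases Finset.mem_insert.mp hl' with rfl | h
          · exact hl1
          · exact hQ1 _ h
        · intro x hx y hy hxy
          rcases Finset.mem_insert.mp hx with rfl | hx2
          · rcases Finset.mem_insert.mp hy with rfl | hy
            · exact absurd rfl hxy
            · exact hd _ hy
          · rcases Finset.mem_insert.mp hy with rfl | hy
            · exact (hd _ hx2).symm
            · exact hQ2 _ hx2 _ hy hxy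
        · rw [Finset.biUnion_insert, hQ3, hl2, Finset.insert_union, Finset.union_sdiff_of_subset hB]
      · rintro ⟨h1, h2, h3⟩
        have : a ∈ P.biUnion supp := h3 ▸ Finset.mem_insert_self _ _
        obtain ⟨l, hl, hal⟩ := Finset.mem_biUnion.mp this
        have hsub : supp l ⊆ insert a A' := h3 ▸ Finset.subset_biUnion_of_mem supp hl
        have hB : (supp l).erase a ⊆ A' := by
          intro x hx
          rw [Finset.mem_erase] at hx
          exact (Finset.mem_insert.mp (hsub hx.2)).resolve_left hx.1
        refine ⟨⟨(supp l).erase a, l, P.erase l⟩, ⟨hB, ?_, ?_⟩, Finset.insert_erase hl⟩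
        · exact ((hLF _ hB).1 l).2 ⟨h1 l hl, (Finset.insert_erase hal).symm⟩
        · refine ((hPF _ hB).1 _).2 ⟨fun x hx => h1 x (Finset.mem_of_mem_erase hx),
            fun x hx y hy => h2 x (Finset.mem_of_mem_erase hx) y (Finset.mem_of_mem_erase hy), ?_⟩
          ext x
          simp only [Finset.mem_biUnion, Finset.mem_erase, Finset.mem_sdiff]
          constructor
          · rintro ⟨l', ⟨hne, hl'⟩, hx⟩
            have hdis := h2 l' hl' l hl hne
            have hxl : x ∉ supp l := Finset.disjoint_left.mp hdis hx
            have hxA : x ∈ insert a A' := h3 ▸ Finset.mem_biUnion.mpr ⟨l', hl', hx⟩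
            refine ⟨(Finset.mem_insert.mp hxA).resolve_left ?_, fun h => hxl h.2⟩
            rintro rfl
            exact hxl hal
          · rintro ⟨hxA, hx⟩
            have hxP : x ∈ P.biUnion supp := h3 ▸ Finset.mem_insert_of_mem hxA
            obtain ⟨l', hl', hxl'⟩ := Finset.mem_biUnion.mp hxP
            refine ⟨l', ⟨?_, hl'⟩, hxl'⟩
            rintro rfl
            refine hx ⟨?_, hxl'⟩
            rintro rfl
            exact ha hxA
    · rw [Finset.card_image_of_injOn, Finset.card_sigma]
      · push_cast
        rw [Finset.sum_congr rfl (g := fun B : Finset ℕ =>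
          ((B.card + 1).factorial : ℚ) * q ^ B.card * lahTot q (m - B.card))]
        · rw [Finset.sum_powerset_apply_card
            (fun j => ((j + 1).factorial : ℚ) * q ^ j * lahTot q (m - j)), hA', lahTot_succ]
          simp [nsmul_eq_mul]
        · intro B hB
          rw [Finset.mem_powerset] at hB
          rw [Finset.card_product, Nat.cast_mul, (hLF B hB).2, (hPF B hB).2]
      · rintro ⟨B, l, Q⟩ hx ⟨B', l', Q'⟩ hy hxy
        simp only [Finset.coe_sigma, Set.mem_sigma_iff, Finset.mem_coe, Finset.mem_powerset,
          Finset.mem_product] at hx hy hxy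
        obtain ⟨hB, hl, hQ⟩ := hx
        obtain ⟨hB', hl', hQ'⟩ := hy
        have hl2 := (((hLF B hB).1 l).1 hl).2
        have hl2' := (((hLF B' hB').1 l').1 hl').2
        have hQ3 := (((hPF B hB).1 Q).1 hQ).2.2
        have hQ3' := (((hPF B' hB').1 Q').1 hQ').2.2
        have hn : ∀ x ∈ Q, a ∉ supp x := by
          intro x hx hax
          have : a ∈ A' \ B := hQ3 ▸ Finset.mem_biUnion.mpr ⟨x, hx, hax⟩
          exact ha (Finset.mem_sdiff.mp this).1
        have hn' : ∀ x ∈ Q', a ∉ supp x := by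
          intro x hx hax
          have : a ∈ A' \ B' := hQ3' ▸ Finset.mem_biUnion.mpr ⟨x, hx, hax⟩
          exact ha (Finset.mem_sdiff.mp this).1
        have hal : a ∈ supp l := hl2 ▸ Finset.mem_insert_self _ _
        have hal' : a ∈ supp l' := hl2' ▸ Finset.mem_insert_self _ _
        have hll : l = l' := by
          have : l ∈ insert l' Q' := hxy ▸ Finset.mem_insert_self _ _
          exact (Finset.mem_insert.mp this).resolve_right fun h => hn' l h hal
        subst hll
        have hBB : B = B' := by
          have e1 : (supp l).erase a = B := by
            rw [hl2, Finset.erase_insert (fun h => ha (hB h))]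
          have e2 : (supp l).erase a = B' := by
            rw [hl2', Finset.erase_insert (fun h => ha (hB' h))]
          rw [← e1, e2]
        subst hBB
        have hQQ : Q = Q' := by
          rw [← Finset.erase_insert (fun h => hn l h hal), hxy,
            Finset.erase_insert (fun h => hn' l h hal)]
        rw [hQQ]

theorem listCount (B : Finset ℕ) : ∃ F : Finset (List ℕ),
    (∀ l, l ∈ F ↔ l.Nodup ∧ l.toFinset = B) ∧ F.card = B.card.factorial := by
  refine ⟨B.toList.permutations.toFinset, fun l => ?_, ?_⟩
  · rw [List.mem_toFinset, List.mem_permutations]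
    constructor
    · intro h
      refine ⟨h.nodup_iff.mpr B.nodup_toList, ?_⟩
      rw [List.toFinset_eq_of_perm _ _ h, Finset.toList_toFinset]
    · rintro ⟨h1, rfl⟩
      exact (List.toFinset_toList h1).symm
  · rw [List.toFinset_card_of_nodup (List.nodup_permutations _ B.nodup_toList),
      List.length_permutations, Finset.length_toList]

/-- All signings of a list of naturals with last entry kept positive. -/
def signings : List ℕ → Finset (List ℤ)
  | [] => ∅
  | [a] => {[(a : ℤ)]}
  | a :: b :: t => (signings (b :: t)).image (List.cons (a : ℤ)) ∪
      (signings (b :: t)).image (List.cons (-(a : ℤ)))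

theorem mem_signings (m : List ℕ) (hm : 0 ∉ m) (l : List ℤ) :
    l ∈ signings m ↔ l ≠ [] ∧ 0 < l.getLastD 0 ∧ l.map Int.natAbs = m := by
  induction m generalizing l with
  | nil => simp [signings]; tauto
  | cons a m ih =>
    have ha : a ≠ 0 := fun h => hm (by simp [h])
    have hm' : 0 ∉ m := fun h => hm (by simp [h])
    match m with
    | [] =>
      simp only [signings, Finset.mem_singleton]
      constructor
      · rintro rfl; simp; omega
      · rintro ⟨h1, h2, h3⟩
        match l with
        | [] => simp at h3
        | [x] => simp at h2 h3 ⊢; omega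
        | x :: y :: t => simp at h3
    | b :: t =>
      simp only [signings, Finset.mem_union, Finset.mem_image]
      constructor
      · rintro (⟨l', hl', rfl⟩ | ⟨l', hl', rfl⟩)
        all_goals
          obtain ⟨h1, h2, h3⟩ := (ih hm' l').1 hl'
          match l' with
          | [] => simp at h1
          | y :: s => exact ⟨by simp, by simpa using h2, by simp [← h3]⟩
      · rintro ⟨h1, h2, h3⟩
        match l with
        | [] => simp at h3
        | [x] => simp at h3
        | x :: y :: s =>
          rw [List.map_cons, List.cons.injEq] at h3
          have hs : y :: s ∈ signings (b :: t) := (ih hm' _).2 ⟨by simp, by simpa using h2, h3.2⟩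
          rcases Int.natAbs_eq_iff.mp h3.1 with h | h
          · exact Or.inl ⟨_, hs, by rw [h]⟩
          · exact Or.inr ⟨_, hs, by rw [h]⟩

theorem card_signings (m : List ℕ) (hm : 0 ∉ m) (hne : m ≠ []) :
    (signings m).card = 2 ^ (m.length - 1) := by
  induction m with
  | nil => exact absurd rfl hne
  | cons a m ih =>
    have ha : a ≠ 0 := fun h => hm (by simp [h])
    have hm' : 0 ∉ m := fun h => hm (by simp [h])
    match m with
    | [] => simp [signings]
    | b :: t =>
      have := ih hm' (by simp)
      rw [signings, Finset.card_union_of_disjoint, Finset.card_image_of_injective _ List.cons_injective,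
        Finset.card_image_of_injective _ List.cons_injective, this]
      · simp [pow_succ]; ring
      · rw [Finset.disjoint_left]
        simp only [Finset.mem_image]
        rintro _ ⟨x, _, rfl⟩ ⟨y, _, h⟩
        rw [List.cons.injEq] at h
        omega

/-- Validity of signed lists without the support condition. -/
def SV (l : List ℤ) : Prop :=
  l ≠ [] ∧ (∀ x ∈ l, x ≠ 0) ∧ (l.map Int.natAbs).Nodup ∧ 0 < l.getLastD 0

theorem signedCount (B : Finset ℕ) (hB : B.Nonempty) (h0 : 0 ∉ B) : ∃ F : Finset (List ℤ),
    (∀ l, l ∈ F ↔ SV l ∧ (l.map Int.natAbs).toFinset = B) ∧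
      (F.card : ℚ) = (B.card.factorial : ℚ) * 2 ^ (B.card - 1) := by
  obtain ⟨F, hF1, hF2⟩ := listCount B
  have hz : ∀ m ∈ F, 0 ∉ m := by
    intro m hm h
    rw [← ((hF1 m).1 hm).2] at h0
    exact h0 (List.mem_toFinset.mpr h)
  refine ⟨F.biUnion signings, fun l => ?_, ?_⟩
  · rw [Finset.mem_biUnion]
    constructor
    · rintro ⟨m, hm, hl⟩
      obtain ⟨h1, h2, rfl⟩ := (mem_signings m (hz m hm) l).1 hl
      obtain ⟨h4, h5⟩ := (hF1 _).1 hm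
      refine ⟨⟨h1, ?_, h4, h2⟩, h5⟩
      rintro x hx rfl
      exact hz _ hm (List.mem_map.mpr ⟨0, hx, rfl⟩)
    · rintro ⟨⟨h1, h2, h3, h4⟩, h5⟩
      have hm := (hF1 _).2 ⟨h3, h5⟩
      exact ⟨_, hm, (mem_signings _ (hz _ hm) l).2 ⟨h1, h4, rfl⟩⟩
  · rw [Finset.card_biUnion]
    · rw [Finset.sum_congr rfl (g := fun _ => 2 ^ (B.card - 1))]
      · simp [hF2]
      · intro m hm
        obtain ⟨h4, h5⟩ := (hF1 _).1 hm
        have hlen : m.length = B.card := by rw [← h5, List.toFinset_card_of_nodup h4]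
        rw [card_signings m (hz m hm), hlen]
        rintro rfl
        simp at h5
        simp [← h5] at hB
    · intro x hx y hy hxy
      rw [Function.onFun_apply, Finset.disjoint_left]
      intro l hl hl'
      exact hxy (((mem_signings x (hz x hx) l).1 hl).2.2.symm.trans
        ((mem_signings y (hz y hy) l).1 hl').2.2)

theorem pilCount_eq (n : ℕ) : (pilCount n : ℚ) = lahTot 1 n := by
  obtain ⟨F, hF1, hF2⟩ := isPart_count (fun l : List ℕ => l.Nodup ∧ l ≠ []) (fun l => l.toFinset)
    (fun l hl => by rw [List.toFinset_nonempty_iff]; exact hl.2) 1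
    (fun B hB _ => by
      obtain ⟨F, h1, h2⟩ := listCount B
      refine ⟨F, fun l => ?_, by simp [h2]⟩
      rw [h1]
      constructor
      · rintro ⟨h3, rfl⟩
        exact ⟨⟨h3, by simpa using hB⟩, rfl⟩
      · rintro ⟨h3, h4⟩
        exact ⟨h3.1, h4⟩) n (Finset.Icc 1 n) (by simp) (by simp)
  have : {P : Finset (List ℕ) | IsPIL (Finset.Icc 1 n) P} = (F : Set (Finset (List ℕ))) := by
    ext P
    rw [Finset.mem_coe, hF1]
    rfl
  rw [pilCount, this, Set.ncard_coe_finset, hF2]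

theorem spilCount_eq (n : ℕ) : (spilCount n : ℚ) = lahTot 2 n := by
  obtain ⟨F, hF1, hF2⟩ := isPart_count SV (fun l => (l.map Int.natAbs).toFinset)
    (fun l hl => by rw [List.toFinset_nonempty_iff]; simpa using hl.1) 2
    signedCount n (Finset.Icc 1 n) (by simp) (by simp)
  have : {P : Finset (List ℤ) | IsSPIL (Finset.Icc 1 n) P} = (F : Set (Finset (List ℤ))) := by
    ext P
    rw [Finset.mem_coe, hF1]
    constructor
    · rintro ⟨h1, h2, h3⟩
      exact ⟨fun l hl => ⟨(h1 l hl).1, fun x hx => ((h1 l hl).2.1 x hx).1, (h1 l hl).2.2⟩, h2, h3⟩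
    · rintro ⟨h1, h2, h3⟩
      refine ⟨fun l hl => ⟨(h1 l hl).1, fun x hx => ⟨(h1 l hl).2.1 x hx, ?_⟩, (h1 l hl).2.2⟩, h2, h3⟩
      rw [← h3, Finset.mem_biUnion]
      exact ⟨l, hl, List.mem_toFinset.mpr (List.mem_map.mpr ⟨x, hx, rfl⟩)⟩
  rw [spilCount, this, Set.ncard_coe_finset, hF2]

/-- `|SPIL(n)| = ∑_{k=1}^{n} L(n,k) · |PIL(k)|`, where
`L(n,k) = (n!/k!) · C(n-1, k-1)` is the Lah number. -/
theorem statement13 (n : ℕ) (hn : 1 ≤ n) :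
    spilCount n =
      ∑ k ∈ Finset.Icc 1 n,
        (n.factorial / k.factorial) * (n - 1).choose (k - 1) * pilCount k := by
  obtain ⟨m, rfl⟩ : ∃ m, n = m + 1 := ⟨n - 1, by omega⟩
  have hq : (spilCount (m + 1) : ℚ) = ((∑ k ∈ Finset.Icc 1 (m + 1),
        ((m + 1).factorial / k.factorial) * (m + 1 - 1).choose (k - 1) * pilCount k : ℕ) : ℚ) := by
    rw [spilCount_eq, lahTot_transform, Finset.range_eq_Ico,
      Finset.sum_Ico_add' (fun k => lahQ (m + 1) k * lahTot 1 k) 0 (m + 1) 1]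
    push_cast
    refine Finset.sum_congr (by ext; simp) fun k hk => ?_
    rw [Finset.mem_Icc] at hk
    obtain ⟨k, rfl⟩ : ∃ j, k = j + 1 := ⟨k - 1, by omega⟩
    rw [pilCount_eq, Nat.cast_div (Nat.factorial_dvd_factorial (by omega)) (by positivity)]
    simp [lahQ]
  exact_mod_cast hq

end
end
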